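/- arXiv:2503.12859 — 2 statements merged into one kernel-verified Lean document; each statement's English description precedes it below -/
import Mathlib

section
/- Let {G_α : α ∈ [0,1]} be a family of n×n real matrices such that for every α, G_α is an inverse M-matrix with positive definite symmetric part, each entry α ↦ G_{α,ij} is differentiable with derivative of constant sign in α, and for each α let ℓ_α be a 1-permanental random vector with kernel G_α. Assume additionally that G₀,ᵢᵢ = G₁,ᵢᵢ for all i and G₁,ᵢⱼ ≥ G₀,ᵢⱼ for all i ≠ j. Then for every s ∈ ℝ₊ⁿ, P( ℓ₁,ᵢ ≤ sᵢ for all i ) ≥ P( ℓ₀,ᵢ ≤ sᵢ for all i ). In particular, maxᵢ ℓ₀,ᵢ stochastically dominates maxᵢ ℓ₁,ᵢ: for every x ≥ 0, P( maxᵢ ℓ₀,ᵢ ≥ x ) ≥ P( maxᵢ ℓ₁,ᵢ ≥ x ). -/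
open Matrix MeasureTheory

lemma wc_inv_nonneg {n : ℕ} (B : Matrix (Fin n) (Fin n) ℝ)
    (hoff : ∀ i j, i ≠ j → B i j ≤ 0)
    (hpd : ∀ x : Fin n → ℝ, x ≠ 0 → 0 < x ⬝ᵥ B.mulVec x)
    (y : Fin n → ℝ) (hy : ∀ i, 0 ≤ B.mulVec y i) (i : Fin n) : 0 ≤ y i := by
  set p : Fin n → ℝ := fun i => max (y i) 0 with hp
  set q : Fin n → ℝ := fun i => max (-y i) 0 with hq
  have hypq : y = p - q := by
    funext k
    simp only [hp, hq, Pi.sub_apply]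
    rcases le_total (y k) 0 with h | h
    · rw [max_eq_right h, max_eq_left (by linarith)]; ring
    · rw [max_eq_left h, max_eq_right (by linarith)]; ring
  have hq0 : ∀ k, 0 ≤ q k := fun k => le_max_right _ _
  have hp0 : ∀ k, 0 ≤ p k := fun k => le_max_right _ _
  have hpq : ∀ k, q k * p k = 0 := by
    intro k
    simp only [hp, hq]
    rcases le_total (y k) 0 with h | h
    · rw [max_eq_right h]; ring
    · rw [max_eq_right (a := -y k) (by linarith)]; ring
  have h1 : 0 ≤ q ⬝ᵥ B.mulVec y :=
    Finset.sum_nonneg fun k _ => mul_nonneg (hq0 k) (hy k)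
  have h2 : q ⬝ᵥ B.mulVec p ≤ 0 := by
    simp only [dotProduct, mulVec, Finset.mul_sum]
    refine Finset.sum_nonpos fun k _ => Finset.sum_nonpos fun l _ => ?_
    by_cases hkl : k = l
    · subst hkl
      have := hpq k
      have : q k * (B k k * p k) = B k k * (q k * p k) := by ring
      rw [this, hpq k]; simp
    · have := hoff k l hkl
      have h3 := mul_nonneg (hq0 k) (hp0 l)
      nlinarith
  have h3 : q = 0 := by
    by_contra hne
    have h4 := hpd q hne
    rw [hypq, mulVec_sub, dotProduct_sub] at h1
    linarith
  have h5 := congrFun hypq i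
  rw [h3] at h5
  simp at h5
  rw [h5]; exact hp0 i

lemma wc_kernel {n : ℕ} (G : Matrix (Fin n) (Fin n) ℝ) (hinv : IsUnit G.det)
    (hM : ∀ i j, i ≠ j → G⁻¹ i j ≤ 0)
    (hpd : ∀ x : Fin n → ℝ, x ≠ 0 → 0 < x ⬝ᵥ G.mulVec x)
    (lam : Fin n → ℝ) (hlam : ∀ i, 0 ≤ lam i) :
    ∃ A : Matrix (Fin n) (Fin n) ℝ, A * (G⁻¹ + diagonal lam) = 1 ∧ ∀ i j, 0 ≤ A i j := by
  set B := G⁻¹ + diagonal lam with hB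
  have hoff : ∀ i j, i ≠ j → B i j ≤ 0 := by
    intro i j hij
    simp [hB, hij, hM i j hij]
  have hpd' : ∀ x : Fin n → ℝ, x ≠ 0 → 0 < x ⬝ᵥ B.mulVec x := by
    intro x hx
    rw [hB, add_mulVec, dotProduct_add]
    have h1 : 0 ≤ x ⬝ᵥ (diagonal lam).mulVec x := by
      refine Finset.sum_nonneg fun k _ => ?_
      rw [mulVec_diagonal]
      nlinarith [hlam k, mul_self_nonneg (x k), mul_nonneg (hlam k) (mul_self_nonneg (x k))]
    have h2 : 0 < x ⬝ᵥ G⁻¹.mulVec x := by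
      have h3 : G.mulVec (G⁻¹.mulVec x) = x := by
        rw [mulVec_mulVec, mul_nonsing_inv _ hinv, one_mulVec]
      have h4 : G⁻¹.mulVec x ≠ 0 := by
        intro h; rw [h, mulVec_zero] at h3; exact hx h3.symm
      have h5 := hpd _ h4
      rw [h3, dotProduct_comm] at h5
      exact h5
    linarith
  have hunit : IsUnit B := by
    rw [← Matrix.mulVec_injective_iff_isUnit]
    intro a b hab
    by_contra hne
    have h1 := hpd' (a - b) (sub_ne_zero.mpr hne)
    have hab' : B.mulVec a = B.mulVec b := hab
    rw [mulVec_sub, hab', sub_self, dotProduct_zero] at h1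
    exact lt_irrefl _ h1
  have hdet := (Matrix.isUnit_iff_isUnit_det B).mp hunit
  refine ⟨B⁻¹, nonsing_inv_mul _ hdet, fun i j => ?_⟩
  have h1 : ∀ k, 0 ≤ B.mulVec (fun k => B⁻¹ k j) k := by
    intro k
    have h2 : B.mulVec (fun k => B⁻¹ k j) k = (B * B⁻¹) k j := by
      simp [mulVec, dotProduct, mul_apply]
    rw [h2, mul_nonsing_inv _ hdet, one_apply]
    split_ifs <;> norm_num
  exact wc_inv_nonneg B hoff hpd' _ h1 i

/-- sign of derivative -/
lemma wc_sign (f f' : ℝ → ℝ)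
    (hd : ∀ α ∈ Set.Icc (0 : ℝ) 1, HasDerivWithinAt f (f' α) (Set.Icc (0 : ℝ) 1) α)
    (hs : (∀ α ∈ Set.Icc (0 : ℝ) 1, 0 ≤ f' α) ∨ (∀ α ∈ Set.Icc (0 : ℝ) 1, f' α ≤ 0))
    (h01 : f 0 ≤ f 1) : ∀ α ∈ Set.Icc (0 : ℝ) 1, 0 ≤ f' α := by
  rcases hs with hs | hs
  · exact hs
  · have hanti : AntitoneOn f (Set.Icc 0 1) := by
      refine antitoneOn_of_hasDerivWithinAt_nonpos (f' := f') (convex_Icc 0 1)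
        (fun x hx => (hd x hx).continuousWithinAt) ?_ ?_
      · intro x hx
        exact (hd x (interior_subset hx)).mono interior_subset
      · intro x hx
        exact hs x (interior_subset hx)
    intro α hα
    have hc : ∀ x ∈ Set.Icc (0 : ℝ) 1, f x = f 0 := by
      intro x hx
      have h1 := hanti (Set.left_mem_Icc.mpr zero_le_one) hx hx.1
      have h2 := hanti hx (Set.right_mem_Icc.mpr zero_le_one) hx.2
      linarith
    have h0 : HasDerivWithinAt f 0 (Set.Icc (0 : ℝ) 1) α :=
      (hasDerivWithinAt_const α (Set.Icc (0 : ℝ) 1) (f 0)).congr hc (hc α hα)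
    rw [(uniqueDiffOn_Icc zero_lt_one α hα).eq_deriv _ (hd α hα) h0]

/-- coefficientwise derivative of a path of power series -/
def WcHasD {n : ℕ} (f : ℝ → MvPowerSeries (Fin n) ℝ) (f' : MvPowerSeries (Fin n) ℝ) (α : ℝ) : Prop :=
  ∀ m, HasDerivWithinAt (fun a => MvPowerSeries.coeff m (f a)) (MvPowerSeries.coeff m f')
    (Set.Icc (0 : ℝ) 1) α

section
variable {n : ℕ} {α : ℝ}

lemma WcHasD.const (c : MvPowerSeries (Fin n) ℝ) : WcHasD (fun _ => c) 0 α := by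
  intro m
  simpa using hasDerivWithinAt_const α (Set.Icc (0 : ℝ) 1) (MvPowerSeries.coeff m c)

lemma WcHasD.add {f g : ℝ → MvPowerSeries (Fin n) ℝ} {f' g'} (hf : WcHasD f f' α)
    (hg : WcHasD g g' α) : WcHasD (fun a => f a + g a) (f' + g') α := by
  intro m
  simpa using (hf m).fun_add (hg m)

lemma WcHasD.sum {ι : Type*} (s : Finset ι) {f : ι → ℝ → MvPowerSeries (Fin n) ℝ}
    {f' : ι → MvPowerSeries (Fin n) ℝ}
    (hf : ∀ i ∈ s, WcHasD (f i) (f' i) α) :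
    WcHasD (fun a => ∑ i ∈ s, f i a) (∑ i ∈ s, f' i) α := by
  intro m
  simpa using HasDerivWithinAt.fun_sum fun i hi => hf i hi m

lemma WcHasD.mul {f g : ℝ → MvPowerSeries (Fin n) ℝ} {f' g'} (hf : WcHasD f f' α)
    (hg : WcHasD g g' α) : WcHasD (fun a => f a * g a) (f' * g α + f α * g') α := by
  intro m
  simp only [MvPowerSeries.coeff_mul, map_add]
  rw [← Finset.sum_add_distrib]
  exact HasDerivWithinAt.fun_sum fun i _ => (hf i.1).fun_mul (hg i.2)

lemma WcHasD.prod {ι : Type*} [DecidableEq ι] (s : Finset ι)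
    {f : ι → ℝ → MvPowerSeries (Fin n) ℝ}
    {f' : ι → MvPowerSeries (Fin n) ℝ}
    (hf : ∀ i ∈ s, WcHasD (f i) (f' i) α) :
    WcHasD (fun a => ∏ i ∈ s, f i a) (∑ i ∈ s, ∏ j ∈ s, if j = i then f' j else f j α) α := by
  induction s using Finset.induction_on with
  | empty => simpa using WcHasD.const (α := α) (1 : MvPowerSeries (Fin n) ℝ)
  | insert a s ha ih =>
    have h1 := (hf a (Finset.mem_insert_self a s)).mul
      (ih fun i hi => hf i (Finset.mem_insert_of_mem hi))
    simp only [Finset.prod_insert ha, Finset.sum_insert ha]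
    convert h1 using 1
    congr 1
    · simp only [if_true]
      congr 1
      refine Finset.prod_congr rfl fun j hj => ?_
      rw [if_neg]; rintro rfl; exact ha hj
    · rw [Finset.mul_sum]
      refine Finset.sum_congr rfl fun i hi => ?_
      rw [if_neg]; rintro rfl; exact ha hi

lemma WcHasD.congr_deriv {f : ℝ → MvPowerSeries (Fin n) ℝ} {f' g'} (hf : WcHasD f f' α)
    (h : f' = g') : WcHasD f g' α := h ▸ hf

lemma WcHasD.det {W : ℝ → Matrix (Fin n) (Fin n) (MvPowerSeries (Fin n) ℝ)}
    {W' : Matrix (Fin n) (Fin n) (MvPowerSeries (Fin n) ℝ)}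
    (h : ∀ i j, WcHasD (fun a => W a i j) (W' i j) α) :
    WcHasD (fun a => (W a).det) (∑ i, ∑ j, (W α).adjugate i j * W' j i) α := by
  have h1 : WcHasD (fun a => (W a).det) (∑ σ : Equiv.Perm (Fin n),
      ((Equiv.Perm.sign σ : ℤ) : MvPowerSeries (Fin n) ℝ) *
        ∑ i, ∏ j, if j = i then W' (σ j) j else W α (σ j) j) α := by
    simp only [Matrix.det_apply']
    refine WcHasD.sum _ fun σ _ => ?_
    refine ((WcHasD.const _).mul (WcHasD.prod Finset.univ (f := fun j a => W a (σ j) j)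
      (f' := fun j => W' (σ j) j) fun i _ => h _ _)).congr_deriv ?_
    simp
  refine h1.congr_deriv ?_
  simp only [Finset.mul_sum]
  rw [Finset.sum_comm]
  refine Finset.sum_congr rfl fun i _ => ?_
  have h2 : ∑ j, (W α).adjugate i j * W' j i = ((W α).updateCol i (fun j => W' j i)).det := by
    rw [← Matrix.cramer_apply, Matrix.cramer_eq_adjugate_mulVec]
    rfl
  rw [h2, Matrix.det_apply']
  refine Finset.sum_congr rfl fun σ _ => ?_
  congr 1
  refine Finset.prod_congr rfl fun j _ => ?_
  rw [Matrix.updateCol_apply]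
  split_ifs with hj
  · rw [hj]
  · rfl

/-- Inverses are differentiable. -/
lemma WcHasD.inv {D P : ℝ → MvPowerSeries (Fin n) ℝ} {D'}
    (hα : α ∈ Set.Icc (0 : ℝ) 1)
    (hD : WcHasD D D' α) (hDP : ∀ a ∈ Set.Icc (0 : ℝ) 1, D a * P a = 1) :
    WcHasD P (- (P α * P α * D')) α := by
  classical
  have hd0 : ∀ a ∈ Set.Icc (0 : ℝ) 1, MvPowerSeries.coeff 0 (D a) ≠ 0 := by
    intro a ha h0
    have := congrArg (MvPowerSeries.coeff 0) (hDP a ha)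
    rw [MvPowerSeries.coeff_mul] at this
    simp at this
    simp at h0
    rw [h0] at this
    simp at this
  have hdiff : ∀ N : ℕ, ∀ m : Fin n →₀ ℕ, m.degree = N →
      DifferentiableWithinAt ℝ (fun a => MvPowerSeries.coeff m (P a)) (Set.Icc (0 : ℝ) 1) α := by
    intro N
    induction N using Nat.strong_induction_on with
    | _ N ih =>
    intro m hm
    have key : ∀ a ∈ Set.Icc (0 : ℝ) 1, MvPowerSeries.coeff m (P a) =
        (MvPowerSeries.coeff m (1 : MvPowerSeries (Fin n) ℝ) -
          ∑ p ∈ (Finset.HasAntidiagonal.antidiagonal m).erase (0, m),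
            MvPowerSeries.coeff p.1 (D a) * MvPowerSeries.coeff p.2 (P a)) /
          MvPowerSeries.coeff 0 (D a) := by
      intro a ha
      have h1 := congrArg (MvPowerSeries.coeff m) (hDP a ha)
      rw [MvPowerSeries.coeff_mul, ← Finset.add_sum_erase _ _
        (show ((0 : Fin n →₀ ℕ), m) ∈ Finset.HasAntidiagonal.antidiagonal m by simp)] at h1
      rw [eq_div_iff (hd0 a ha), ← h1]
      ring
    refine DifferentiableWithinAt.congr ?_ key (key α hα)
    refine DifferentiableWithinAt.fun_div ?_ (hD 0).differentiableWithinAt (hd0 α hα)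
    refine DifferentiableWithinAt.fun_sub (differentiableWithinAt_const _) ?_
    refine DifferentiableWithinAt.fun_sum fun p hp => ?_
    refine (hD p.1).differentiableWithinAt.fun_mul ?_
    refine ih p.2.degree ?_ p.2 rfl
    rw [Finset.mem_erase, Finset.HasAntidiagonal.mem_antidiagonal] at hp
    have h2 : p.1 ≠ 0 := by
      intro h0
      apply hp.1
      have := hp.2
      rw [h0, zero_add] at this
      exact Prod.ext h0 this
    have h3 : 0 < p.1.degree := by
      rw [pos_iff_ne_zero]
      intro h; exact h2 ((Finsupp.degree_eq_zero_iff _).mp h)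
    rw [← hm, ← hp.2, map_add]
    omega
  obtain ⟨P', hP'⟩ : ∃ P', WcHasD P P' α :=
    ⟨fun m => derivWithin (fun a => MvPowerSeries.coeff m (P a)) (Set.Icc (0 : ℝ) 1) α,
      fun m => (hdiff _ m rfl).hasDerivWithinAt⟩
  refine hP'.congr_deriv ?_
  have h1 := hD.mul hP'
  have h2 : D' * P α + D α * P' = 0 := by
    ext m
    refine (uniqueDiffOn_Icc zero_lt_one α hα).eq_deriv _ (h1 m) ?_
    have := WcHasD.const (α := α) (1 : MvPowerSeries (Fin n) ℝ) m
    refine this.congr ?_ ?_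
    · intro x hx; simp only; rw [hDP x hx]
    · simp only; rw [hDP α hα]
  have h3 := hDP α hα
  linear_combination (P α) * h2 - P' * h3

/-- nonnegative coefficients -/
def WcNN (f : MvPowerSeries (Fin n) ℝ) : Prop := ∀ m, 0 ≤ MvPowerSeries.coeff m f

lemma WcNN.mul {f g : MvPowerSeries (Fin n) ℝ} (hf : WcNN f) (hg : WcNN g) : WcNN (f * g) := by
  intro m
  rw [MvPowerSeries.coeff_mul]
  exact Finset.sum_nonneg fun p _ => mul_nonneg (hf _) (hg _)

lemma WcNN.sum {ι : Type*} (s : Finset ι) {f : ι → MvPowerSeries (Fin n) ℝ}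
    (hf : ∀ i ∈ s, WcNN (f i)) : WcNN (∑ i ∈ s, f i) := by
  intro m
  rw [map_sum]
  exact Finset.sum_nonneg fun i hi => hf i hi m

lemma WcNN.C {c : ℝ} (hc : 0 ≤ c) : WcNN (MvPowerSeries.C (σ := Fin n) c) := by
  classical
  intro m
  rw [MvPowerSeries.coeff_C]
  split_ifs
  · exact hc
  · exact le_rfl

lemma wc_coeff_X_mul (k : Fin n) (f : MvPowerSeries (Fin n) ℝ) (m : Fin n →₀ ℕ) :
    MvPowerSeries.coeff m (MvPowerSeries.X k * f) =
      if 1 ≤ m k then MvPowerSeries.coeff (m - Finsupp.single k 1) f else 0 := by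
  classical
  rw [MvPowerSeries.X, MvPowerSeries.coeff_monomial_mul]
  simp [Finsupp.single_le_iff]

/-- Solutions of `K = A + A Λ X K` are nonnegative. -/
lemma wc_K_nonneg (A : Matrix (Fin n) (Fin n) ℝ) (hA : ∀ i j, 0 ≤ A i j)
    (lam : Fin n → ℝ) (hlam : ∀ i, 0 ≤ lam i)
    (K : Matrix (Fin n) (Fin n) (MvPowerSeries (Fin n) ℝ))
    (hK : ∀ i j, K i j = MvPowerSeries.C (A i j) +
      ∑ c, MvPowerSeries.C (A i c * lam c) * (MvPowerSeries.X c * K c j)) :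
    ∀ i j, WcNN (K i j) := by
  classical
  have key : ∀ N : ℕ, ∀ m : Fin n →₀ ℕ, m.degree = N → ∀ i j,
      0 ≤ MvPowerSeries.coeff m (K i j) := by
    intro N
    induction N using Nat.strong_induction_on with
    | _ N ih =>
    intro m hm i j
    rw [hK, map_add, map_sum]
    refine add_nonneg (WcNN.C (hA i j) m) (Finset.sum_nonneg fun c _ => ?_)
    rw [MvPowerSeries.coeff_C_mul, wc_coeff_X_mul]
    refine mul_nonneg (mul_nonneg (hA i c) (hlam c)) ?_
    split_ifs with hc
    · refine ih _ ?_ _ rfl c j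
      have h1 : (m - Finsupp.single c 1) + Finsupp.single c 1 = m :=
        tsub_add_cancel_of_le (Finsupp.single_le_iff.mpr hc)
      have h2 := congrArg Finsupp.degree h1
      rw [map_add, Finsupp.degree_single, hm] at h2
      omega
    · exact le_rfl
  exact fun i j m => key _ m rfl i j

/-- The series whose coefficients are one exactly on exponents supported in `T`. -/
def wcS (T : Finset (Fin n)) : MvPowerSeries (Fin n) ℝ :=
  fun m => if ∀ k, k ∉ T → m k = 0 then 1 else 0

lemma wcS_nn (T : Finset (Fin n)) : WcNN (wcS T) := by
  intro m
  rw [MvPowerSeries.coeff_apply, wcS]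
  split_ifs <;> norm_num

lemma wcS_erase (T : Finset (Fin n)) (k : Fin n) (hk : k ∈ T) :
    (1 - MvPowerSeries.X k) * wcS T = wcS (T.erase k) := by
  classical
  ext m
  rw [sub_mul, one_mul, map_sub, wc_coeff_X_mul]
  simp only [MvPowerSeries.coeff_apply, wcS]
  have e1 : (∀ l, l ∉ T → (m - Finsupp.single k 1 : Fin n →₀ ℕ) l = 0) ↔ (∀ l, l ∉ T → m l = 0) := by
    refine forall_congr' fun l => imp_congr_right fun hl => ?_
    have : k ≠ l := by rintro rfl; exact hl hk
    simp [Finsupp.single_apply, this]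
  have e2 : (∀ l, l ∉ T.erase k → m l = 0) ↔ (m k = 0 ∧ ∀ l, l ∉ T → m l = 0) := by
    constructor
    · intro h
      refine ⟨h k (by simp), fun l hl => h l (by simp [hl])⟩
    · rintro ⟨h1, h2⟩ l hl
      by_cases hlk : l = k
      · rw [hlk, h1]
      · exact h2 l (by simpa [hlk] using hl)
  simp only [e1, e2]
  by_cases h0 : m k = 0
  · simp [h0]
  · have : 1 ≤ m k := by omega
    simp [h0, this]

end

/-- The matrix `1 + Λ(1 - X) G` over power series. -/
noncomputable def wcW {n : ℕ} (lam : Fin n → ℝ) (G : Matrix (Fin n) (Fin n) ℝ) :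
    Matrix (Fin n) (Fin n) (MvPowerSeries (Fin n) ℝ) :=
  1 + diagonal (fun i => MvPowerSeries.C (lam i) * (1 - MvPowerSeries.X i)) *
    (MvPowerSeries.C (σ := Fin n) (R := ℝ)).mapMatrix G

lemma wcW_apply {n : ℕ} (lam : Fin n → ℝ) (G : Matrix (Fin n) (Fin n) ℝ) (i j : Fin n) :
    wcW lam G i j = (1 : Matrix (Fin n) (Fin n) (MvPowerSeries (Fin n) ℝ)) i j +
      MvPowerSeries.C (lam i) * (1 - MvPowerSeries.X i) * MvPowerSeries.C (G i j) := by
  rw [wcW, Matrix.add_apply, diagonal_mul]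
  rfl

lemma wcW_hasD {n : ℕ} (lam : Fin n → ℝ) (G : ℝ → Matrix (Fin n) (Fin n) ℝ)
    (G' : Matrix (Fin n) (Fin n) ℝ) (α : ℝ)
    (h : ∀ i j, HasDerivWithinAt (fun a => G a i j) (G' i j) (Set.Icc (0 : ℝ) 1) α) (i j : Fin n) :
    WcHasD (fun a => wcW lam (G a) i j)
      (MvPowerSeries.C (lam i) * (1 - MvPowerSeries.X i) * MvPowerSeries.C (G' i j)) α := by
  classical
  simp only [wcW_apply]
  have h1 : WcHasD (fun a => MvPowerSeries.C (σ := Fin n) (G a i j))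
      (MvPowerSeries.C (G' i j)) α := by
    intro m
    simp only [MvPowerSeries.coeff_C]
    split_ifs
    · exact h i j
    · exact hasDerivWithinAt_const _ _ _
  refine ((WcHasD.const _).add ((WcHasD.const _).mul h1)).congr_deriv ?_
  simp

lemma wc_step {n : ℕ} (lam : Fin n → ℝ) (hlam : ∀ i, 0 ≤ lam i)
    (G : Matrix (Fin n) (Fin n) ℝ) (G' : Matrix (Fin n) (Fin n) ℝ)
    (hinv : IsUnit G.det) (hM : ∀ i j, i ≠ j → G⁻¹ i j ≤ 0)
    (hpd : ∀ x : Fin n → ℝ, x ≠ 0 → 0 < x ⬝ᵥ G.mulVec x)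
    (hd : ∀ i, G' i i = 0) (ho : ∀ i j, 0 ≤ G' i j)
    (P : MvPowerSeries (Fin n) ℝ) (hP : WcNN P) (hDP : (wcW lam G).det * P = 1) :
    WcNN (wcS Finset.univ * (- (P * P * (∑ i, ∑ j, (wcW lam G).adjugate i j *
      (MvPowerSeries.C (lam j) * (1 - MvPowerSeries.X j) * MvPowerSeries.C (G' j i)))))) := by
  obtain ⟨A, hA1, hA0⟩ := wc_kernel G hinv hM hpd lam hlam
  set φ := (MvPowerSeries.C (σ := Fin n) (R := ℝ)).mapMatrix (m := Fin n) with hφ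
  set V := P • (wcW lam G).adjugate with hV
  set M : Matrix (Fin n) (Fin n) (MvPowerSeries (Fin n) ℝ) :=
    diagonal (fun i => MvPowerSeries.C (lam i) * (1 - MvPowerSeries.X i)) with hMdef
  have hWV : wcW lam G * V = 1 := by
    rw [hV, Matrix.mul_smul, Matrix.mul_adjugate, smul_smul, mul_comm P, hDP, one_smul]
  set K := φ G * V with hK
  have hVK : V = 1 - M * K := by
    have h1 : wcW lam G = 1 + M * φ G := rfl
    rw [h1, Matrix.add_mul, Matrix.one_mul, Matrix.mul_assoc] at hWV
    exact eq_sub_of_add_eq hWV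
  have hGG : φ G⁻¹ * φ G = 1 := by
    rw [← map_mul, nonsing_inv_mul _ hinv, map_one]
  have hKeq : K = φ A + φ A * ((φ (diagonal lam) - M) * K) := by
    have h1 : φ A * (φ G⁻¹ + φ (diagonal lam)) = 1 := by
      rw [← map_add, ← map_mul, hA1, map_one]
    have h2 : φ G⁻¹ * K = V := by
      rw [hK, ← Matrix.mul_assoc, hGG, Matrix.one_mul]
    calc K = φ A * (φ G⁻¹ + φ (diagonal lam)) * K := by rw [h1, Matrix.one_mul]
      _ = φ A * (V + φ (diagonal lam) * K) := by
          rw [Matrix.mul_assoc, Matrix.add_mul, h2]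
      _ = φ A * (1 - M * K + φ (diagonal lam) * K) := by rw [← hVK]
      _ = _ := by
          rw [Matrix.sub_mul]
          noncomm_ring
  have hφd : φ (diagonal lam) - M =
      diagonal (fun i => MvPowerSeries.C (lam i) * MvPowerSeries.X i) := by
    rw [hφ, RingHom.mapMatrix_apply, Matrix.diagonal_map (by simp), hMdef, Matrix.diagonal_sub]
    congr 1
    funext i
    ring
  have hKnn : ∀ i j, WcNN (K i j) := by
    refine wc_K_nonneg A hA0 lam hlam K fun i j => ?_
    conv_lhs => rw [hKeq, hφd]
    rw [Matrix.add_apply, Matrix.mul_apply]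
    congr 1
    refine Finset.sum_congr rfl fun c _ => ?_
    rw [Matrix.diagonal_mul, map_mul]
    simp only [hφ, RingHom.mapMatrix_apply, Matrix.map_apply]
    ring
  have hterm : ∀ i j, WcNN (wcS Finset.univ * (-(P * (V i j *
      (MvPowerSeries.C (lam j) * (1 - MvPowerSeries.X j) * MvPowerSeries.C (G' j i)))))) := by
    intro i j
    by_cases hij : i = j
    · subst hij
      rw [hd]
      simp only [map_zero, mul_zero, neg_zero]
      intro m; simp
    · have h1 : V i j = - (MvPowerSeries.C (lam i) * (1 - MvPowerSeries.X i) * K i j) := by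
        rw [hVK, Matrix.sub_apply, hMdef, Matrix.diagonal_mul, Matrix.one_apply_ne hij]
        ring
      have h2 : wcS Finset.univ * (-(P * (V i j *
        (MvPowerSeries.C (lam j) * (1 - MvPowerSeries.X j) * MvPowerSeries.C (G' j i))))) =
          MvPowerSeries.C (lam i) * (MvPowerSeries.C (lam j) * (MvPowerSeries.C (G' j i) *
          (P * (K i j * ((1 - MvPowerSeries.X j) * ((1 - MvPowerSeries.X i) *
            wcS Finset.univ)))))) := by
        rw [h1]; ring
      rw [h2, wcS_erase _ _ (Finset.mem_univ i), wcS_erase _ _ (by simp [Ne.symm hij])]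
      exact (WcNN.C (hlam i)).mul ((WcNN.C (hlam j)).mul ((WcNN.C (ho j i)).mul
        (hP.mul ((hKnn i j).mul (wcS_nn _)))))
  have hfin : wcS Finset.univ * (- (P * P * (∑ i, ∑ j, (wcW lam G).adjugate i j *
      (MvPowerSeries.C (lam j) * (1 - MvPowerSeries.X j) * MvPowerSeries.C (G' j i))))) =
      ∑ i, ∑ j, wcS Finset.univ * (-(P * (V i j *
      (MvPowerSeries.C (lam j) * (1 - MvPowerSeries.X j) * MvPowerSeries.C (G' j i))))) := by
    simp only [Finset.mul_sum, ← Finset.sum_neg_distrib]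
    refine Finset.sum_congr rfl fun i _ => Finset.sum_congr rfl fun j _ => ?_
    rw [hV, Matrix.smul_apply, smul_eq_mul]
    ring
  rw [hfin]
  exact WcNN.sum _ fun i _ => WcNN.sum _ fun j _ => hterm i j

lemma wc_mono {n : ℕ} (lam : Fin n → ℝ) (hlam : ∀ i, 0 ≤ lam i)
    (G : ℝ → Matrix (Fin n) (Fin n) ℝ) (G' : ℝ → Matrix (Fin n) (Fin n) ℝ)
    (hderiv : ∀ i j, ∀ α ∈ Set.Icc (0 : ℝ) 1,
      HasDerivWithinAt (fun a => G a i j) (G' α i j) (Set.Icc (0 : ℝ) 1) α)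
    (hinvble : ∀ α ∈ Set.Icc (0 : ℝ) 1, IsUnit (G α).det)
    (hMmat : ∀ α ∈ Set.Icc (0 : ℝ) 1, ∀ i j, i ≠ j → (G α)⁻¹ i j ≤ 0)
    (hpd : ∀ α ∈ Set.Icc (0 : ℝ) 1, ∀ x : Fin n → ℝ, x ≠ 0 → 0 < x ⬝ᵥ (G α).mulVec x)
    (hd : ∀ α ∈ Set.Icc (0 : ℝ) 1, ∀ i, G' α i i = 0)
    (ho : ∀ α ∈ Set.Icc (0 : ℝ) 1, ∀ i j, 0 ≤ G' α i j)
    (P : ℝ → MvPowerSeries (Fin n) ℝ) (hP : ∀ α ∈ Set.Icc (0 : ℝ) 1, WcNN (P α))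
    (hDP : ∀ α ∈ Set.Icc (0 : ℝ) 1, (wcW lam (G α)).det * P α = 1) (m : Fin n →₀ ℕ) :
    MvPowerSeries.coeff m (wcS Finset.univ * P 0) ≤
      MvPowerSeries.coeff m (wcS Finset.univ * P 1) := by
  have h1 : ∀ α ∈ Set.Icc (0 : ℝ) 1, WcHasD (fun a => wcS Finset.univ * P a)
      (wcS Finset.univ * (- (P α * P α * (∑ i, ∑ j, (wcW lam (G α)).adjugate i j *
      (MvPowerSeries.C (lam j) * (1 - MvPowerSeries.X j) * MvPowerSeries.C (G' α j i)))))) α := by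
    intro α hα
    have h2 := WcHasD.det (W := fun a => wcW lam (G a))
      (W' := fun i j => MvPowerSeries.C (lam i) * (1 - MvPowerSeries.X i) *
        MvPowerSeries.C (G' α i j)) (fun i j => wcW_hasD lam G (G' α) α
          (fun i j => hderiv i j α hα) i j)
    refine ((WcHasD.const (wcS Finset.univ)).mul (h2.inv hα hDP)).congr_deriv ?_
    rw [zero_mul, zero_add]
  have hmono : MonotoneOn (fun a => MvPowerSeries.coeff m (wcS Finset.univ * P a))
      (Set.Icc 0 1) := by
    refine monotoneOn_of_hasDerivWithinAt_nonneg (convex_Icc 0 1)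
      (fun x hx => (h1 x hx m).continuousWithinAt)
      (fun x hx => (h1 x (interior_subset hx) m).mono interior_subset) ?_
    intro x hx
    have hx' := interior_subset hx
    exact wc_step lam hlam (G x) (G' x) (hinvble x hx') (hMmat x hx') (hpd x hx') (hd x hx')
      (ho x hx') (P x) (hP x hx') (hDP x hx') m
  exact hmono (Set.left_mem_Icc.mpr zero_le_one) (Set.right_mem_Icc.mpr zero_le_one) zero_le_one

lemma wc_hasSum_congr {ι : Type*} {f g : ι → ℝ} {a : ℝ} (h : HasSum f a) (e : g = f) :
    HasSum g a := e ▸ h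

lemma wc_hasSum_exp : ∀ (n : ℕ) (x : Fin n → ℝ), (∀ i, 0 ≤ x i) →
    HasSum (fun m : Fin n → ℕ => ∏ k, x k ^ m k / (m k).factorial) (∏ k, Real.exp (x k)) := by
  intro n
  induction n with
  | zero =>
    intro x _
    simp
  | succ n ih =>
    intro x hx
    have h0 : HasSum (fun k : ℕ => x 0 ^ k / (k.factorial : ℝ)) (Real.exp (x 0)) := by
      rw [Real.exp_eq_exp_ℝ]
      exact NormedSpace.expSeries_div_hasSum_exp (x 0)
    have h1 := ih (fun i => x i.succ) (fun i => hx _)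
    have hs := h0.summable.mul_of_nonneg h1.summable (fun k => by have := hx 0; positivity)
      (fun m => Finset.prod_nonneg fun k _ => by have := hx k.succ; positivity)
    have h2 := h0.mul h1 hs
    rw [← (Fin.consEquiv (fun _ : Fin (n+1) => ℕ)).hasSum_iff]
    rw [Fin.prod_univ_succ]
    refine wc_hasSum_congr h2 (funext fun p => ?_)
    simp [Fin.prod_univ_succ, Fin.consEquiv, mul_div_mul_comm]

lemma wc_unique_one (a : ℕ → ℝ) (h : ∀ t ∈ Set.Icc (0 : ℝ) 1, HasSum (fun k => a k * t ^ k) 0) :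
    a = 0 := by
  have hsum : Summable (fun k => |a k|) := by
    have := (h 1 (by simp)).summable
    simpa using this.abs
  set S := ∑' k, |a k| with hS
  funext k
  induction k using Nat.strong_induction_on with
  | _ k ih =>
  have key : ∀ t : ℝ, 0 < t → t ≤ 1 → |a k| ≤ t * S := by
    intro t ht ht1
    have h1 := h t ⟨ht.le, ht1⟩
    have h2 := h1.summable.sum_add_tsum_nat_add (k + 1)
    have hz : ∑ i ∈ Finset.range k, a i * t ^ i = 0 := by
      refine Finset.sum_eq_zero fun i hi => ?_
      have h5 := ih i (Finset.mem_range.mp hi)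
      simp only [Pi.zero_apply] at h5
      rw [h5, zero_mul]
    rw [h1.tsum_eq, Finset.sum_range_succ, hz, zero_add] at h2
    · have h3 : a k * t ^ k = - ∑' i, a (i + (k + 1)) * t ^ (i + (k + 1)) :=
        eq_neg_of_add_eq_zero_left h2
      have hs1 : Summable (fun i => |a (i + (k + 1))|) := 
        (summable_nat_add_iff (f := fun j => |a j|) (k + 1)).mpr hsum
      have hle : ∀ i, |a (i + (k + 1)) * t ^ (i + (k + 1))| ≤ |a (i + (k + 1))| * t ^ (k + 1) := by
        intro i
        rw [abs_mul, abs_of_nonneg (pow_nonneg ht.le _)]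
        refine mul_le_mul_of_nonneg_left ?_ (abs_nonneg _)
        exact pow_le_pow_of_le_one ht.le ht1 (by omega)
      have hs2 : Summable (fun i => |a (i + (k + 1)) * t ^ (i + (k + 1))|) :=
        Summable.of_nonneg_of_le (fun i => abs_nonneg _) hle (hs1.mul_right _)
      have h4 : |a k| * t ^ k ≤ S * t ^ (k + 1) := by
        calc |a k| * t ^ k = |a k * t ^ k| := by
              rw [abs_mul, abs_of_nonneg (pow_nonneg ht.le _)]
          _ = |∑' i, a (i + (k + 1)) * t ^ (i + (k + 1))| := by rw [h3, abs_neg]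
          _ ≤ ∑' i, |a (i + (k + 1)) * t ^ (i + (k + 1))| := by
              have := norm_tsum_le_tsum_norm (f := fun i => a (i + (k + 1)) * t ^ (i + (k + 1))) hs2
              simpa [Real.norm_eq_abs] using this
          _ ≤ ∑' i, |a (i + (k + 1))| * t ^ (k + 1) := hs2.tsum_le_tsum hle (hs1.mul_right _)
          _ = (∑' i, |a (i + (k + 1))|) * t ^ (k + 1) := tsum_mul_right
          _ ≤ S * t ^ (k + 1) := by
              refine mul_le_mul_of_nonneg_right ?_ (pow_nonneg ht.le _)
              have := hsum.sum_add_tsum_nat_add (k + 1)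
              have h5 : 0 ≤ ∑ i ∈ Finset.range (k + 1), |a i| :=
                Finset.sum_nonneg fun i _ => abs_nonneg _
              linarith
      have hp := pow_pos ht k
      rw [pow_succ] at h4
      have h6 : |a k| * t ^ k ≤ (t * S) * t ^ k := by nlinarith
      exact le_of_mul_le_mul_right h6 hp
  have hS0 : 0 ≤ S := tsum_nonneg fun _ => abs_nonneg _
  by_contra hne
  have hpos : 0 < |a k| := abs_pos.mpr hne
  have hkey1 := key 1 one_pos le_rfl
  have hSp : 0 < S := by linarith
  have h7 := key (|a k| / (2 * S)) (by positivity) (by rw [div_le_one (by positivity)]; linarith)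
  have h8 : |a k| / (2 * S) * S = |a k| / 2 := by field_simp
  linarith

lemma wc_unique : ∀ (n : ℕ) (f : (Fin n → ℕ) → ℝ),
    (∀ z : Fin n → ℝ, (∀ i, z i ∈ Set.Icc (0 : ℝ) 1) → HasSum (fun m => f m * ∏ k, z k ^ m k) 0) →
    f = 0 := by
  intro n
  induction n with
  | zero =>
    intro f h
    have h1 := h (fun _ => 0) (fun i => i.elim0)
    have h2 := hasSum_unique (fun m : Fin 0 → ℕ => f m * ∏ k : Fin 0, (0 : ℝ) ^ m k)
    have h3 := h1.unique h2
    funext m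
    rw [Finset.univ_eq_empty, Finset.prod_empty, mul_one] at h3
    rw [Pi.zero_apply, h3]
    exact congrArg f (Subsingleton.elim _ _)
  | succ n ih =>
    intro f h
    have hs : ∀ (z : Fin n → ℝ), (∀ i, z i ∈ Set.Icc (0 : ℝ) 1) → ∀ t ∈ Set.Icc (0 : ℝ) 1,
        HasSum (fun p : ℕ × (Fin n → ℕ) =>
          f (Fin.cons p.1 p.2) * (∏ k, z k ^ p.2 k) * t ^ p.1) 0 := by
      intro z hz t ht
      have h1 := h (Fin.cons t z) (fun i => by
        refine Fin.cases ?_ (fun i => ?_) i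
        · simpa using ht
        · simpa using hz i)
      rw [← (Fin.consEquiv (fun _ : Fin (n+1) => ℕ)).hasSum_iff] at h1
      convert h1 using 1
      funext p
      simp [Fin.prod_univ_succ, Fin.consEquiv]
      ring
    have hs1 : ∀ (z : Fin n → ℝ), (∀ i, z i ∈ Set.Icc (0 : ℝ) 1) → ∀ k : ℕ,
        Summable (fun m : Fin n → ℕ => f (Fin.cons k m) * (∏ k, z k ^ m k)) := by
      intro z hz k
      have := (hs z hz 1 (by simp)).summable.prod_factor k
      simpa using this
    have key : ∀ k : ℕ, (fun m : Fin n → ℕ => f (Fin.cons k m)) = 0 := by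
      intro k
      refine ih _ fun z hz => ?_
      have h1 := wc_unique_one
        (fun k => ∑' m : Fin n → ℕ, f (Fin.cons k m) * (∏ k, z k ^ m k)) (fun t ht => by
          refine (hs z hz t ht).prod_fiberwise fun k => ?_
          exact (hs1 z hz k).hasSum.mul_right _)
      have h2 := congrFun h1 k
      have h3 := (hs1 z hz k).hasSum
      simp only [Pi.zero_apply] at h2
      rwa [h2] at h3
    funext m
    have := congrFun (key (m 0)) (Fin.tail m)
    simpa using this

lemma wc_hasSum_mul {n : ℕ} (f g : MvPowerSeries (Fin n) ℝ) (z : Fin n → ℝ) (a b : ℝ)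
    (hf : HasSum (fun m : Fin n →₀ ℕ => MvPowerSeries.coeff m f * ∏ k, z k ^ m k) a)
    (hg : HasSum (fun m : Fin n →₀ ℕ => MvPowerSeries.coeff m g * ∏ k, z k ^ m k) b) :
    HasSum (fun m : Fin n →₀ ℕ => MvPowerSeries.coeff m (f * g) * ∏ k, z k ^ m k) (a * b) := by
  set u : (Fin n →₀ ℕ) → ℝ := fun m => MvPowerSeries.coeff m f * ∏ k, z k ^ m k with hu
  set v : (Fin n →₀ ℕ) → ℝ := fun m => MvPowerSeries.coeff m g * ∏ k, z k ^ m k with hv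
  have hs : Summable (fun x : (Fin n →₀ ℕ) × (Fin n →₀ ℕ) => u x.1 * v x.2) :=
    summable_mul_of_summable_norm hf.summable.norm hg.summable.norm
  have h1 : (∑' m, u m) * (∑' m, v m) =
      ∑' m, ∑ p ∈ Finset.HasAntidiagonal.antidiagonal m, u p.1 * v p.2 :=
    hf.summable.tsum_mul_tsum_eq_tsum_sum_antidiagonal hg.summable hs
  have h2 : Summable (fun m => ∑ p ∈ Finset.HasAntidiagonal.antidiagonal m, u p.1 * v p.2) :=
    summable_sum_mul_antidiagonal_of_summable_mul hs
  rw [hf.tsum_eq, hg.tsum_eq] at h1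
  rw [h1]
  refine wc_hasSum_congr h2.hasSum (funext fun m => ?_)
  rw [MvPowerSeries.coeff_mul, Finset.sum_mul]
  refine Finset.sum_congr rfl fun p hp => ?_
  rw [Finset.HasAntidiagonal.mem_antidiagonal] at hp
  have : ∏ k, z k ^ m k = (∏ k, z k ^ p.1 k) * ∏ k, z k ^ p.2 k := by
    rw [← Finset.prod_mul_distrib]
    refine Finset.prod_congr rfl fun k _ => ?_
    rw [← pow_add, ← hp]; rfl
  rw [this]
  simp only [hu, hv]
  ring

lemma wc_hasSum_det {n : ℕ} (lam : Fin n → ℝ) (G : Matrix (Fin n) (Fin n) ℝ) (z : Fin n → ℝ) :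
    HasSum (fun m : Fin n →₀ ℕ => MvPowerSeries.coeff m (wcW lam G).det * ∏ k, z k ^ m k)
      (1 + diagonal (fun i => lam i * (1 - z i)) * G).det := by
  classical
  set Wp : Matrix (Fin n) (Fin n) (MvPolynomial (Fin n) ℝ) :=
    1 + diagonal (fun i => MvPolynomial.C (lam i) * (1 - MvPolynomial.X i)) *
      (MvPolynomial.C (σ := Fin n) (R := ℝ)).mapMatrix G with hWp
  have hWpa : ∀ i j, Wp i j = (1 : Matrix (Fin n) (Fin n) (MvPolynomial (Fin n) ℝ)) i j +
      MvPolynomial.C (lam i) * (1 - MvPolynomial.X i) * MvPolynomial.C (G i j) := by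
    intro i j
    rw [hWp, Matrix.add_apply, diagonal_mul]
    rfl
  have h1 : wcW lam G = (MvPolynomial.coeToMvPowerSeries.ringHom (σ := Fin n) (R := ℝ)).mapMatrix
      Wp := by
    ext1 i j
    rw [wcW_apply, RingHom.mapMatrix_apply, Matrix.map_apply, hWpa, map_add, map_mul, map_mul,
      map_sub]
    by_cases hij : i = j
    · subst hij; simp
    · simp [hij]
  have h2 : (1 + diagonal (fun i => lam i * (1 - z i)) * G) = (MvPolynomial.eval z).mapMatrix Wp := by
    ext1 i j
    rw [Matrix.add_apply, diagonal_mul, RingHom.mapMatrix_apply, Matrix.map_apply, hWpa]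
    by_cases hij : i = j
    · subst hij; simp
    · simp [hij]
  rw [h1, h2, ← RingHom.map_det, ← RingHom.map_det, MvPolynomial.eval_eq']
  simp only [MvPolynomial.coeToMvPowerSeries.ringHom_apply, MvPolynomial.coeff_coe]
  refine hasSum_sum_of_ne_finset_zero fun m hm => ?_
  rw [MvPolynomial.notMem_support_iff.mp hm, zero_mul]

/-- A Poisson weight. -/
noncomputable def wcT (x : ℝ) (j : ℕ) : ℝ := Real.exp (-x) * (x ^ j / (j.factorial : ℝ))

lemma wcT_nonneg {x : ℝ} (hx : 0 ≤ x) (j : ℕ) : 0 ≤ wcT x j := by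
  unfold wcT; positivity

lemma wcT_le_one {x : ℝ} (hx : 0 ≤ x) (j : ℕ) : wcT x j ≤ 1 := by
  unfold wcT
  have h := Real.pow_div_factorial_le_exp x hx j
  calc _ ≤ Real.exp (-x) * Real.exp x := by gcongr
    _ = 1 := by rw [← Real.exp_add]; simp

lemma wcT_measurable (j : ℕ) : Measurable (fun x => wcT x j) := by
  unfold wcT; fun_prop

section
variable {n : ℕ} {Ω : Type} [MeasurableSpace Ω] (μ : Measure Ω) [IsProbabilityMeasure μ]

/-- The multivariate generating series. -/
noncomputable def wcP (lam : Fin n → ℝ) (ℓ : Ω → Fin n → ℝ) : MvPowerSeries (Fin n) ℝ :=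
  fun m => ∫ ω, ∏ k, wcT (lam k * ℓ ω k) (m k) ∂μ

lemma wc_prod_meas (lam : Fin n → ℝ) (ℓ : Ω → Fin n → ℝ) (hℓ : Measurable ℓ) (m : Fin n → ℕ) :
    Measurable (fun ω => ∏ k, wcT (lam k * ℓ ω k) (m k)) := by
  refine Finset.measurable_prod _ fun k _ => ?_
  exact (wcT_measurable (m k)).comp (by fun_prop)

lemma wc_prod_int (lam : Fin n → ℝ) (hlam : ∀ i, 0 ≤ lam i) (ℓ : Ω → Fin n → ℝ)
    (hℓ : Measurable ℓ) (hpos : ∀ ω i, 0 ≤ ℓ ω i) (m : Fin n → ℕ) :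
    Integrable (fun ω => ∏ k, wcT (lam k * ℓ ω k) (m k)) μ := by
  refine Integrable.of_bound (wc_prod_meas lam ℓ hℓ m).aestronglyMeasurable 1
    (Filter.Eventually.of_forall fun ω => ?_)
  have h0 : ∀ k, 0 ≤ lam k * ℓ ω k := fun k => mul_nonneg (hlam k) (hpos ω k)
  rw [Real.norm_eq_abs, abs_of_nonneg (Finset.prod_nonneg fun k _ => wcT_nonneg (h0 k) _)]
  exact Finset.prod_le_one (fun k _ => wcT_nonneg (h0 k) _) fun k _ => wcT_le_one (h0 k) _

lemma wcP_nn (lam : Fin n → ℝ) (hlam : ∀ i, 0 ≤ lam i) (ℓ : Ω → Fin n → ℝ)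
    (hpos : ∀ ω i, 0 ≤ ℓ ω i) : WcNN (wcP μ lam ℓ) := by
  intro m
  rw [MvPowerSeries.coeff_apply, wcP]
  exact integral_nonneg fun ω => Finset.prod_nonneg fun k _ =>
    wcT_nonneg (mul_nonneg (hlam k) (hpos ω k)) _

lemma wc_hasSum_P (lam : Fin n → ℝ) (hlam : ∀ i, 0 ≤ lam i) (ℓ : Ω → Fin n → ℝ)
    (hℓ : Measurable ℓ) (hpos : ∀ ω i, 0 ≤ ℓ ω i) (z : Fin n → ℝ)
    (hz : ∀ i, z i ∈ Set.Icc (0 : ℝ) 1) :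
    HasSum (fun m : Fin n →₀ ℕ => MvPowerSeries.coeff m (wcP μ lam ℓ) * ∏ k, z k ^ m k)
      (∫ ω, Real.exp (-(∑ i, lam i * (1 - z i) * ℓ ω i)) ∂μ) := by
  have h0 : ∀ ω k, 0 ≤ lam k * ℓ ω k := fun ω k => mul_nonneg (hlam k) (hpos ω k)
  have hpt : ∀ ω, HasSum (fun m : Fin n → ℕ =>
      (∏ k, wcT (lam k * ℓ ω k) (m k)) * ∏ k, z k ^ m k)
      (Real.exp (-(∑ i, lam i * (1 - z i) * ℓ ω i))) := by
    intro ω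
    have h1 := wc_hasSum_exp n (fun k => lam k * ℓ ω k * z k)
      (fun k => mul_nonneg (h0 ω k) (hz k).1)
    have h2 := h1.mul_left (∏ k, Real.exp (-(lam k * ℓ ω k)))
    have h3 : (∏ k, Real.exp (-(lam k * ℓ ω k))) * (∏ k, Real.exp (lam k * ℓ ω k * z k)) =
        Real.exp (-(∑ i, lam i * (1 - z i) * ℓ ω i)) := by
      rw [← Real.exp_sum, ← Real.exp_sum, ← Real.exp_add, ← Finset.sum_add_distrib,
        ← Finset.sum_neg_distrib]
      congr 1
      refine Finset.sum_congr rfl fun k _ => ?_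
      ring
    rw [← h3]
    refine wc_hasSum_congr h2 (funext fun m => ?_)
    rw [← Finset.prod_mul_distrib, ← Finset.prod_mul_distrib]
    refine Finset.prod_congr rfl fun k _ => ?_
    rw [wcT, mul_pow]; ring
  have hnn : ∀ ω (m : Fin n → ℕ), 0 ≤ (∏ k, wcT (lam k * ℓ ω k) (m k)) * ∏ k, z k ^ m k := by
    intro ω m
    exact mul_nonneg (Finset.prod_nonneg fun k _ => wcT_nonneg (h0 ω k) _)
      (Finset.prod_nonneg fun k _ => pow_nonneg (hz k).1 _)
  have hseries : HasSum (fun m : Fin n → ℕ =>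
      ∫ ω, (∏ k, wcT (lam k * ℓ ω k) (m k)) * ∏ k, z k ^ m k ∂μ)
      (∫ ω, Real.exp (-(∑ i, lam i * (1 - z i) * ℓ ω i)) ∂μ) := by
    refine hasSum_integral_of_dominated_convergence
      (fun m ω => (∏ k, wcT (lam k * ℓ ω k) (m k)) * ∏ k, z k ^ m k) ?_ ?_ ?_ ?_ ?_
    · intro m
      exact ((wc_prod_meas lam ℓ hℓ m).mul_const _).aestronglyMeasurable
    · intro m
      refine Filter.Eventually.of_forall fun ω => ?_
      rw [Real.norm_eq_abs, abs_of_nonneg (hnn ω m)]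
    · exact Filter.Eventually.of_forall fun ω => (hpt ω).summable
    · have : (fun ω => ∑' m : Fin n → ℕ, (∏ k, wcT (lam k * ℓ ω k) (m k)) * ∏ k, z k ^ m k) =
          fun ω => Real.exp (-(∑ i, lam i * (1 - z i) * ℓ ω i)) :=
        funext fun ω => (hpt ω).tsum_eq
      rw [this]
      refine Integrable.of_bound (Measurable.aestronglyMeasurable (by fun_prop)) 1
        (Filter.Eventually.of_forall fun ω => ?_)
      rw [Real.norm_eq_abs, Real.abs_exp, Real.exp_le_one_iff, neg_nonpos]
      refine Finset.sum_nonneg fun k _ => ?_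
      exact mul_nonneg (mul_nonneg (hlam k) (by linarith [(hz k).2])) (hpos ω k)
    · exact Filter.Eventually.of_forall fun ω => hpt ω
  rw [← Finsupp.equivFunOnFinite.hasSum_iff] at hseries
  refine wc_hasSum_congr hseries (funext fun m => ?_)
  simp only [Function.comp_apply]
  rw [integral_mul_const]
  rfl

lemma wc_DP (lam : Fin n → ℝ) (hlam : ∀ i, 0 ≤ lam i) (G : Matrix (Fin n) (Fin n) ℝ)
    (ℓ : Ω → Fin n → ℝ) (hℓ : Measurable ℓ) (hpos : ∀ ω i, 0 ≤ ℓ ω i)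
    (hperm : ∀ lam : Fin n → ℝ, (∀ i, 0 ≤ lam i) →
      ∫ ω, Real.exp (-(∑ i, lam i * ℓ ω i)) ∂μ = ((1 + Matrix.diagonal lam * G).det)⁻¹) :
    (wcW lam G).det * wcP μ lam ℓ = 1 := by
  classical
  have key : ∀ z : Fin n → ℝ, (∀ i, z i ∈ Set.Icc (0 : ℝ) 1) →
      HasSum (fun m : Fin n →₀ ℕ => MvPowerSeries.coeff m ((wcW lam G).det * wcP μ lam ℓ - 1) *
        ∏ k, z k ^ m k) 0 := by
    intro z hz
    have h1 := wc_hasSum_mul _ _ z _ _ (wc_hasSum_det lam G z) (wc_hasSum_P μ lam hlam ℓ hℓ hpos z hz)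
    have hl : ∀ i, 0 ≤ lam i * (1 - z i) := fun i =>
      mul_nonneg (hlam i) (by linarith [(hz i).2])
    have h2 := hperm (fun i => lam i * (1 - z i)) hl
    have hpos' : 0 < ∫ ω, Real.exp (-(∑ i, lam i * (1 - z i) * ℓ ω i)) ∂μ := by
      refine integral_exp_pos ?_
      refine Integrable.of_bound (Measurable.aestronglyMeasurable (by fun_prop)) 1
        (Filter.Eventually.of_forall fun ω => ?_)
      rw [Real.norm_eq_abs, Real.abs_exp, Real.exp_le_one_iff, neg_nonpos]
      exact Finset.sum_nonneg fun k _ => mul_nonneg (hl k) (hpos ω k)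
    rw [h2] at hpos' h1
    have h3 : (1 + diagonal (fun i => lam i * (1 - z i)) * G).det ≠ 0 :=
      (inv_pos.mp hpos').ne'
    rw [mul_inv_cancel₀ h3] at h1
    have h4 : HasSum (fun m : Fin n →₀ ℕ =>
        MvPowerSeries.coeff m (1 : MvPowerSeries (Fin n) ℝ) * ∏ k, z k ^ m k) 1 := by
      have := hasSum_single (f := fun m : Fin n →₀ ℕ =>
        MvPowerSeries.coeff m (1 : MvPowerSeries (Fin n) ℝ) * ∏ k, z k ^ m k) 0
        (fun m hm => by rw [MvPowerSeries.coeff_one, if_neg hm, zero_mul])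
      simpa using this
    have h5 := h1.sub h4
    rw [sub_self] at h5
    refine wc_hasSum_congr h5 (funext fun m => ?_)
    rw [map_sub, sub_mul]
  have h6 := wc_unique n (fun m => MvPowerSeries.coeff (Finsupp.equivFunOnFinite.symm m)
    ((wcW lam G).det * wcP μ lam ℓ - 1)) (fun z hz => by
      rw [← Finsupp.equivFunOnFinite.hasSum_iff]
      refine wc_hasSum_congr (key z hz) (funext fun m => ?_)
      simp)
  rw [← sub_eq_zero]
  ext m
  have h7 := congrFun h6 (Finsupp.equivFunOnFinite m)
  simpa using h7

/-- The cumulative coefficients are expectations of products of Poisson cdfs. -/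
lemma wc_cum (lam : Fin n → ℝ) (hlam : ∀ i, 0 ≤ lam i) (ℓ : Ω → Fin n → ℝ)
    (hℓ : Measurable ℓ) (hpos : ∀ ω i, 0 ≤ ℓ ω i) (m : Fin n →₀ ℕ) :
    MvPowerSeries.coeff m (wcS Finset.univ * wcP μ lam ℓ) =
      ∫ ω, ∏ k, ∑ j ∈ Finset.range (m k + 1), wcT (lam k * ℓ ω k) j ∂μ := by
  classical
  have h1 : ∀ ω, ∏ k, ∑ j ∈ Finset.range (m k + 1), wcT (lam k * ℓ ω k) j =
      ∑ p ∈ Fintype.piFinset (fun k => Finset.range (m k + 1)),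
        ∏ k, wcT (lam k * ℓ ω k) (p k) := fun ω => Finset.prod_univ_sum _ _
  simp only [h1]
  rw [integral_finsetSum _ fun p _ => wc_prod_int μ lam hlam ℓ hℓ hpos p, MvPowerSeries.coeff_mul]
  refine Finset.sum_bij' (fun p _ => (p.2 : Fin n → ℕ))
    (fun q _ => (m - Finsupp.equivFunOnFinite.symm q, Finsupp.equivFunOnFinite.symm q)) ?_ ?_ ?_ ?_ ?_
  · intro p hp
    rw [Finset.HasAntidiagonal.mem_antidiagonal] at hp
    rw [Fintype.mem_piFinset]
    intro k
    rw [Finset.mem_range, ← hp, Finsupp.add_apply]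
    omega
  · intro q hq
    rw [Fintype.mem_piFinset] at hq
    rw [Finset.HasAntidiagonal.mem_antidiagonal]
    refine tsub_add_cancel_of_le fun k => ?_
    have := Finset.mem_range.mp (hq k)
    simp
    omega
  · intro p hp
    rw [Finset.HasAntidiagonal.mem_antidiagonal] at hp
    have e : Finsupp.equivFunOnFinite.symm (p.2 : Fin n → ℕ) = p.2 := by
      ext k; simp
    simp only [e]
    refine Prod.ext ?_ rfl
    simp only
    rw [← hp, add_tsub_cancel_right]
  · intro q hq
    funext k
    simp
  · intro p hp
    have : MvPowerSeries.coeff p.1 (wcS (Finset.univ : Finset (Fin n))) = 1 := by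
      rw [MvPowerSeries.coeff_apply, wcS]; simp
    rw [this, one_mul]
    rfl

end

/-- Poisson cdf. -/
noncomputable def wcF (x : ℝ) (N : ℕ) : ℝ := ∑ j ∈ Finset.range (N + 1), wcT x j

lemma wcF_eq (x : ℝ) (N : ℕ) :
    wcF x N = Real.exp (-x) * ∑ j ∈ Finset.range (N + 1), x ^ j / (j.factorial : ℝ) := by
  rw [wcF, Finset.mul_sum]; rfl

lemma wcF_nonneg {x : ℝ} (hx : 0 ≤ x) (N : ℕ) : 0 ≤ wcF x N :=
  Finset.sum_nonneg fun _ _ => wcT_nonneg hx _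

lemma wcF_le_one {x : ℝ} (hx : 0 ≤ x) (N : ℕ) : wcF x N ≤ 1 := by
  rw [wcF_eq]
  calc _ ≤ Real.exp (-x) * Real.exp x := by
        gcongr
        exact Real.sum_le_exp_of_nonneg hx _
    _ = 1 := by rw [← Real.exp_add]; simp

lemma wcF_measurable (N : ℕ) : Measurable (fun x => wcF x N) :=
  Finset.measurable_sum _ fun j _ => wcT_measurable j

lemma wc_rho {θ : ℝ} (hθ : 0 ≤ θ) (h1 : θ ≠ 1) :
    Filter.Tendsto (fun N : ℕ => Real.exp (-(N * θ)) * (θ ^ N * Real.exp N)) Filter.atTop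
      (nhds 0) := by
  have h2 : θ * Real.exp (1 - θ) < 1 := by
    have h3 := Real.add_one_lt_exp (x := θ - 1) (sub_ne_zero.mpr h1)
    have h4 : Real.exp (θ - 1) * Real.exp (1 - θ) = 1 := by rw [← Real.exp_add]; simp
    have h5 := Real.exp_pos (1 - θ)
    nlinarith
  have h3 := tendsto_pow_atTop_nhds_zero_of_lt_one
    (mul_nonneg hθ (Real.exp_pos (1 - θ)).le) h2
  refine h3.congr fun N => ?_
  rw [mul_pow, ← Real.exp_nat_mul]
  have : Real.exp (N * (1 - θ)) = Real.exp (-(N * θ)) * Real.exp N := by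
    rw [← Real.exp_add]; congr 1; ring
  rw [this]; ring

lemma wcF_tendsto_zero {θ : ℝ} (h1 : 1 < θ) :
    Filter.Tendsto (fun N : ℕ => wcF (N * θ) N) Filter.atTop (nhds 0) := by
  have h0 : 0 ≤ θ := by linarith
  refine squeeze_zero (fun N => wcF_nonneg (by positivity) N) (fun N => ?_) (wc_rho h0 h1.ne')
  rw [wcF_eq]
  refine mul_le_mul_of_nonneg_left ?_ (Real.exp_pos _).le
  calc _ ≤ ∑ j ∈ Finset.range (N + 1), θ ^ N * ((N : ℝ) ^ j / (j.factorial : ℝ)) := by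
        refine Finset.sum_le_sum fun j hj => ?_
        have hj' : j ≤ N := Nat.lt_succ_iff.mp (Finset.mem_range.mp hj)
        have h2 : θ ^ j ≤ θ ^ N := pow_le_pow_right₀ h1.le hj'
        rw [mul_pow]
        calc (N : ℝ) ^ j * θ ^ j / (j.factorial : ℝ) = θ ^ j * ((N : ℝ) ^ j / (j.factorial : ℝ)) := by
              ring
          _ ≤ _ := by gcongr
    _ ≤ θ ^ N * Real.exp N := by
        rw [← Finset.mul_sum]
        gcongr
        exact Real.sum_le_exp_of_nonneg (by positivity) _

lemma wcF_tendsto_one {θ : ℝ} (h0 : 0 ≤ θ) (h1 : θ < 1) :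
    Filter.Tendsto (fun N : ℕ => wcF (N * θ) N) Filter.atTop (nhds 1) := by
  have hexp : ∀ x : ℝ, HasSum (fun k : ℕ => x ^ k / (k.factorial : ℝ)) (Real.exp x) := by
    intro x
    rw [Real.exp_eq_exp_ℝ]
    exact NormedSpace.expSeries_div_hasSum_exp x
  have hlow : ∀ N : ℕ, 1 - Real.exp (-(N * θ)) * (θ ^ N * Real.exp N) ≤ wcF (N * θ) N := by
    intro N
    have h2 : HasSum (fun j : ℕ => if j ∈ Finset.range (N + 1)
        then (N * θ) ^ j / (j.factorial : ℝ) else 0)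
        (∑ j ∈ Finset.range (N + 1), (N * θ) ^ j / (j.factorial : ℝ)) := by
      have this : HasSum (fun j : ℕ => if j ∈ Finset.range (N + 1)
          then (N * θ) ^ j / (j.factorial : ℝ) else 0)
          (∑ j ∈ Finset.range (N + 1), if j ∈ Finset.range (N + 1)
          then (N * θ) ^ j / (j.factorial : ℝ) else 0) :=
        hasSum_sum_of_ne_finset_zero (fun j hj => if_neg hj)
      rwa [Finset.sum_congr rfl fun j hj => if_pos hj] at this
    have h3 := h2.add ((hexp N).mul_left (θ ^ N))
    have h4 : Real.exp (N * θ) ≤ (∑ j ∈ Finset.range (N + 1), (N * θ) ^ j / (j.factorial : ℝ)) +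
        θ ^ N * Real.exp N := by
      refine hasSum_le (fun j => ?_) (hexp (N * θ)) h3
      split_ifs with hj
      · have : 0 ≤ θ ^ N * ((N : ℝ) ^ j / (j.factorial : ℝ)) := by positivity
        linarith
      · have hj' : N ≤ j := by
          rw [Finset.mem_range] at hj; omega
        have h5 : θ ^ j ≤ θ ^ N := pow_le_pow_of_le_one h0 h1.le hj'
        rw [zero_add, mul_pow]
        calc (N : ℝ) ^ j * θ ^ j / (j.factorial : ℝ) = θ ^ j * ((N : ℝ) ^ j / (j.factorial : ℝ)) := by
              ring
          _ ≤ _ := by gcongr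
    have h6 := mul_le_mul_of_nonneg_left h4 (Real.exp_pos (-(N * θ))).le
    rw [← Real.exp_add, neg_add_cancel, Real.exp_zero, mul_add, ← wcF_eq] at h6
    linarith
  have hlim := (wc_rho h0 h1.ne).const_sub 1
  rw [sub_zero] at hlim
  exact tendsto_of_tendsto_of_tendsto_of_le_of_le hlim tendsto_const_nhds hlow
    (fun N => wcF_le_one (by positivity) N)

section
variable {n : ℕ} {Ω : Type} [MeasurableSpace Ω] (μ : Measure Ω) [IsProbabilityMeasure μ]

lemma wc_limit (X Y : Ω → Fin n → ℝ) (hX : Measurable X) (hY : Measurable Y)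
    (hX0 : ∀ ω i, 0 ≤ X ω i) (hY0 : ∀ ω i, 0 ≤ Y ω i)
    (hcmp : ∀ (lam : Fin n → ℝ), (∀ i, 0 ≤ lam i) → ∀ N : ℕ,
      ∫ ω, ∏ k, wcF (lam k * X ω k) N ∂μ ≤ ∫ ω, ∏ k, wcF (lam k * Y ω k) N ∂μ)
    (s s' : Fin n → ℝ) (hs : ∀ i, 0 ≤ s i) (hss : ∀ i, s i < s' i) :
    μ.real {ω | ∀ i, X ω i ≤ s i} ≤ μ.real {ω | ∀ i, Y ω i ≤ s' i} := by
  have hs' : ∀ i, 0 < s' i := fun i => (hs i).trans_lt (hss i)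
  set A := {ω | ∀ i, X ω i ≤ s i} with hA
  set B := {ω | ∀ i, Y ω i ≤ s' i} with hB
  have hAm : MeasurableSet A := by
    rw [hA, Set.setOf_forall]
    exact MeasurableSet.iInter fun i => measurableSet_le (by fun_prop) measurable_const
  have hBm : MeasurableSet B := by
    rw [hB, Set.setOf_forall]
    exact MeasurableSet.iInter fun i => measurableSet_le (by fun_prop) measurable_const
  set f : (Ω → Fin n → ℝ) → ℕ → Ω → ℝ := fun Z N ω => ∏ k, wcF ((N * (Z ω k / s' k))) N with hf
  have hf0 : ∀ Z : Ω → Fin n → ℝ, (∀ ω i, 0 ≤ Z ω i) → ∀ N ω, 0 ≤ f Z N ω := by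
    intro Z hZ N ω
    refine Finset.prod_nonneg fun k _ => wcF_nonneg ?_ N
    have := hZ ω k
    have := hs' k
    positivity
  have hf1 : ∀ Z : Ω → Fin n → ℝ, (∀ ω i, 0 ≤ Z ω i) → ∀ N ω, f Z N ω ≤ 1 := by
    intro Z hZ N ω
    refine Finset.prod_le_one (fun k _ => wcF_nonneg ?_ N) (fun k _ => wcF_le_one ?_ N) <;>
    · have := hZ ω k
      have := hs' k
      positivity
  have hfm : ∀ Z : Ω → Fin n → ℝ, Measurable Z → ∀ N, Measurable (f Z N) := by
    intro Z hZ N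
    refine Finset.measurable_prod _ fun k _ => ?_
    exact (wcF_measurable N).comp (by fun_prop)
  have hfi : ∀ Z : Ω → Fin n → ℝ, Measurable Z → (∀ ω i, 0 ≤ Z ω i) → ∀ N,
      Integrable (f Z N) μ := by
    intro Z hZ hZ0 N
    refine Integrable.of_bound (hfm Z hZ N).aestronglyMeasurable 1
      (Filter.Eventually.of_forall fun ω => ?_)
    rw [Real.norm_eq_abs, abs_of_nonneg (hf0 Z hZ0 N ω)]
    exact hf1 Z hZ0 N ω
  have hXY : ∀ N, ∫ ω, f X N ω ∂μ ≤ ∫ ω, f Y N ω ∂μ := by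
    intro N
    have := hcmp (fun k => N / s' k) (fun k => by have := hs' k; positivity) N
    have e : ∀ (Z : Ω → Fin n → ℝ) ω, ∏ k, wcF (N / s' k * Z ω k) N = f Z N ω := by
      intro Z ω
      refine Finset.prod_congr rfl fun k _ => ?_
      congr 1; ring
    simpa only [e] using this
  have hlimA : Filter.Tendsto (fun N => ∫ ω, A.indicator (f X N) ω ∂μ) Filter.atTop
      (nhds (∫ ω, A.indicator 1 ω ∂μ)) := by
    refine tendsto_integral_of_dominated_convergence (fun _ => 1)
      (fun N => ((hfm X hX N).indicator hAm).aestronglyMeasurable) (integrable_const _) ?_ ?_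
    · intro N
      refine Filter.Eventually.of_forall fun ω => ?_
      rw [Set.indicator_apply]
      split_ifs
      · rw [Real.norm_eq_abs, abs_of_nonneg (hf0 X hX0 N ω)]
        exact hf1 X hX0 N ω
      · simp
    · refine Filter.Eventually.of_forall fun ω => ?_
      by_cases hω : ω ∈ A
      · simp only [Set.indicator_of_mem hω, Pi.one_apply]
        have h1 : Filter.Tendsto (fun N => f X N ω) Filter.atTop (nhds (∏ _k : Fin n, (1 : ℝ))) := by
          refine tendsto_finset_prod _ fun k _ => ?_
          refine wcF_tendsto_one (div_nonneg (hX0 ω k) (hs' k).le) ?_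
          rw [div_lt_one (hs' k)]
          exact (hω k).trans_lt (hss k)
        simpa using h1
      · simp only [Set.indicator_of_notMem hω]
        exact tendsto_const_nhds
  have hlimB : Filter.Tendsto (fun N => ∫ ω, Bᶜ.indicator (f Y N) ω ∂μ) Filter.atTop
      (nhds (∫ _, (0 : ℝ) ∂μ)) := by
    refine tendsto_integral_of_dominated_convergence (fun _ => 1)
      (fun N => ((hfm Y hY N).indicator hBm.compl).aestronglyMeasurable) (integrable_const _) ?_ ?_
    · intro N
      refine Filter.Eventually.of_forall fun ω => ?_
      rw [Set.indicator_apply]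
      split_ifs
      · rw [Real.norm_eq_abs, abs_of_nonneg (hf0 Y hY0 N ω)]
        exact hf1 Y hY0 N ω
      · simp
    · refine Filter.Eventually.of_forall fun ω => ?_
      by_cases hω : ω ∈ Bᶜ
      · simp only [Set.indicator_of_mem hω]
        have hex : ∃ k, s' k < Y ω k := by
          by_contra hcon
          push Not at hcon
          exact hω hcon
        obtain ⟨k, hk⟩ := hex
        refine squeeze_zero (fun N => hf0 Y hY0 N ω) (fun N => ?_)
          (wcF_tendsto_zero (θ := Y ω k / s' k) (by rwa [one_lt_div (hs' k)]))
        have hnn : ∀ l, 0 ≤ (N : ℝ) * (Y ω l / s' l) := by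
          intro l
          have := hY0 ω l
          have := hs' l
          positivity
        simp only [hf]
        rw [← Finset.mul_prod_erase _ _ (Finset.mem_univ k)]
        refine mul_le_of_le_one_right (wcF_nonneg (hnn k) N) ?_
        exact Finset.prod_le_one (fun l _ => wcF_nonneg (hnn l) N) (fun l _ => wcF_le_one (hnn l) N)
      · simp only [Set.indicator_of_notMem hω]
        exact tendsto_const_nhds
  rw [integral_zero] at hlimB
  rw [integral_indicator_one hAm] at hlimA
  have hlimB' := hlimB.const_add (μ.real B)
  rw [add_zero] at hlimB'
  refine le_of_tendsto_of_tendsto' hlimA hlimB' fun N => ?_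
  calc ∫ ω, A.indicator (f X N) ω ∂μ ≤ ∫ ω, f X N ω ∂μ := by
        refine integral_mono ((hfi X hX hX0 N).indicator hAm) (hfi X hX hX0 N) fun ω => ?_
        exact Set.indicator_le_self' (fun ω _ => hf0 X hX0 N ω) ω
    _ ≤ ∫ ω, f Y N ω ∂μ := hXY N
    _ ≤ ∫ ω, (B.indicator 1 ω + Bᶜ.indicator (f Y N) ω) ∂μ := by
        have hi1 : Integrable (B.indicator (1 : Ω → ℝ)) μ :=
          (integrable_const (1 : ℝ)).indicator hBm
        refine integral_mono (hfi Y hY hY0 N)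
          (hi1.add ((hfi Y hY hY0 N).indicator hBm.compl)) fun ω => ?_
        by_cases hω : ω ∈ B
        · simpa [hω] using hf1 Y hY0 N ω
        · simp [hω]
    _ = μ.real B + ∫ ω, Bᶜ.indicator (f Y N) ω ∂μ := by
        have hi1 : Integrable (B.indicator (1 : Ω → ℝ)) μ :=
          (integrable_const (1 : ℝ)).indicator hBm
        rw [integral_add hi1 ((hfi Y hY hY0 N).indicator hBm.compl), integral_indicator_one hBm]

lemma wc_closed (X Y : Ω → Fin n → ℝ) (hX : Measurable X) (hY : Measurable Y)
    (hX0 : ∀ ω i, 0 ≤ X ω i) (hY0 : ∀ ω i, 0 ≤ Y ω i)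
    (hcmp : ∀ (lam : Fin n → ℝ), (∀ i, 0 ≤ lam i) → ∀ N : ℕ,
      ∫ ω, ∏ k, wcF (lam k * X ω k) N ∂μ ≤ ∫ ω, ∏ k, wcF (lam k * Y ω k) N ∂μ)
    (s : Fin n → ℝ) (hs : ∀ i, 0 ≤ s i) :
    μ {ω | ∀ i, X ω i ≤ s i} ≤ μ {ω | ∀ i, Y ω i ≤ s i} := by
  have h1 : ∀ j : ℕ, μ {ω | ∀ i, X ω i ≤ s i} ≤ μ {ω | ∀ i, Y ω i ≤ s i + 1 / ((j : ℝ) + 1)} := by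
    intro j
    have := wc_limit μ X Y hX hY hX0 hY0 hcmp s (fun i => s i + 1 / ((j : ℝ) + 1)) hs
      (fun i => by have : 0 < 1 / ((j : ℝ) + 1) := by positivity
                   linarith)
    exact (ENNReal.toReal_le_toReal (measure_ne_top _ _) (measure_ne_top _ _)).mp this
  have h2 : {ω | ∀ i, Y ω i ≤ s i} = ⋂ j : ℕ, {ω | ∀ i, Y ω i ≤ s i + 1 / ((j : ℝ) + 1)} := by
    ext ω
    simp only [Set.mem_setOf_eq, Set.mem_iInter]
    constructor
    · intro h j i
      have : 0 < 1 / ((j : ℝ) + 1) := by positivity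
      linarith [h i]
    · intro h i
      have hlim := (tendsto_one_div_add_atTop_nhds_zero_nat (𝕜 := ℝ)).const_add (s i)
      rw [add_zero] at hlim
      exact ge_of_tendsto' hlim fun j => h j i
  have h3 := tendsto_measure_iInter_atTop (μ := μ)
    (s := fun j : ℕ => {ω | ∀ i, Y ω i ≤ s i + 1 / ((j : ℝ) + 1)}) ?_ ?_ ⟨0, measure_ne_top _ _⟩
  · rw [h2]
    exact ge_of_tendsto' h3 h1
  · intro j
    refine MeasurableSet.nullMeasurableSet ?_
    rw [Set.setOf_forall]
    exact MeasurableSet.iInter fun i => measurableSet_le (by fun_prop) measurable_const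
  · intro a b hab ω hω i
    have := hω i
    have h4 : 1 / ((b : ℝ) + 1) ≤ 1 / ((a : ℝ) + 1) := Nat.one_div_le_one_div hab
    linarith

lemma wc_open (hn : 0 < n) (X Y : Ω → Fin n → ℝ)
    (hX0 : ∀ ω i, 0 ≤ X ω i)
    (hcmp : ∀ s : Fin n → ℝ, (∀ i, 0 ≤ s i) →
      μ {ω | ∀ i, X ω i ≤ s i} ≤ μ {ω | ∀ i, Y ω i ≤ s i}) (x : ℝ) :
    μ {ω | ∀ i, X ω i < x} ≤ μ {ω | ∀ i, Y ω i < x} := by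
  have h2 : {ω | ∀ i, X ω i < x} = ⋃ j : ℕ, {ω | ∀ i, X ω i ≤ x - 1 / ((j : ℝ) + 1)} := by
    ext ω
    simp only [Set.mem_setOf_eq, Set.mem_iUnion]
    constructor
    · intro h
      have hlim := (tendsto_one_div_add_atTop_nhds_zero_nat (𝕜 := ℝ)).const_sub x
      rw [sub_zero] at hlim
      have h5 : ∀ᶠ j : ℕ in Filter.atTop, ∀ i, X ω i ≤ x - 1 / ((j : ℝ) + 1) := by
        rw [Filter.eventually_all]
        intro i
        exact (hlim.eventually (lt_mem_nhds (h i))).mono fun _ hj => hj.le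
      exact h5.exists
    · rintro ⟨j, hj⟩ i
      have : 0 < 1 / ((j : ℝ) + 1) := by positivity
      linarith [hj i]
  have h3 := tendsto_measure_iUnion_atTop (μ := μ)
    (s := fun j : ℕ => {ω | ∀ i, X ω i ≤ x - 1 / ((j : ℝ) + 1)}) ?_
  · rw [h2]
    refine le_of_tendsto' h3 fun j => ?_
    by_cases hneg : 0 ≤ x - 1 / ((j : ℝ) + 1)
    · refine (hcmp (fun _ => x - 1 / ((j : ℝ) + 1)) (fun _ => hneg)).trans (measure_mono ?_)
      intro ω hω i
      have : 0 < 1 / ((j : ℝ) + 1) := by positivity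
      have := hω i
      linarith
    · have : {ω | ∀ i, X ω i ≤ x - 1 / ((j : ℝ) + 1)} = ∅ := by
        ext ω
        simp only [Set.mem_setOf_eq, Set.mem_empty_iff_false, iff_false]
        intro h
        have h6 := h ⟨0, hn⟩
        have h7 := hX0 ω ⟨0, hn⟩
        linarith
      simp only [Function.comp_apply, this, measure_empty, zero_le]
  · intro a b hab ω hω i
    have := hω i
    have h4 : 1 / ((b : ℝ) + 1) ≤ 1 / ((a : ℝ) + 1) := Nat.one_div_le_one_div hab
    linarith

end

/-- **Weak comparison of 1-permanental vectors.** Let `{G_α : α ∈ [0,1]}` be a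
family of inverse M-matrices with positive definite symmetric part, entrywise differentiable in
`α` with derivatives of constant sign, with `ℓ_α` 1-permanental with kernel `G_α`. If moreover
`G₀,ᵢᵢ = G₁,ᵢᵢ` for all `i` and `G₁,ᵢⱼ ≥ G₀,ᵢⱼ` for `i ≠ j`, then
`P(ℓ₁ᵢ ≤ sᵢ ∀i) ≥ P(ℓ₀ᵢ ≤ sᵢ ∀i)` for every `s ∈ ℝ₊ⁿ`; in particular `maxᵢ ℓ₀,ᵢ`
stochastically dominates `maxᵢ ℓ₁,ᵢ`. -/
theorem weak_comparison_onePermanental {n : ℕ} (hn : 0 < n)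
    (G : ℝ → Matrix (Fin n) (Fin n) ℝ) (G' : ℝ → Matrix (Fin n) (Fin n) ℝ)
    (hderiv : ∀ i j, ∀ α ∈ Set.Icc (0 : ℝ) 1,
      HasDerivWithinAt (fun a => G a i j) (G' α i j) (Set.Icc (0 : ℝ) 1) α)
    (hsign : ∀ i j, (∀ α ∈ Set.Icc (0 : ℝ) 1, 0 ≤ G' α i j) ∨
      (∀ α ∈ Set.Icc (0 : ℝ) 1, G' α i j ≤ 0))
    (hnn : ∀ α ∈ Set.Icc (0 : ℝ) 1, ∀ i j, 0 ≤ G α i j)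
    (hinvble : ∀ α ∈ Set.Icc (0 : ℝ) 1, IsUnit (G α).det)
    (hMmat : ∀ α ∈ Set.Icc (0 : ℝ) 1, ∀ i j, i ≠ j → (G α)⁻¹ i j ≤ 0)
    (hpd : ∀ α ∈ Set.Icc (0 : ℝ) 1, ∀ x : Fin n → ℝ, x ≠ 0 → 0 < x ⬝ᵥ (G α).mulVec x)
    {Ω : Type} [MeasurableSpace Ω] (μ : Measure Ω) [IsProbabilityMeasure μ]
    (ℓ : ℝ → Ω → Fin n → ℝ) (hmeas : ∀ α, Measurable (ℓ α))
    (hpos : ∀ α ω i, 0 ≤ ℓ α ω i)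
    (hperm : ∀ α ∈ Set.Icc (0 : ℝ) 1, ∀ lam : Fin n → ℝ, (∀ i, 0 ≤ lam i) →
      ∫ ω, Real.exp (-(∑ i, lam i * ℓ α ω i)) ∂μ =
        ((1 + Matrix.diagonal lam * G α).det)⁻¹)
    (hdiag : ∀ i, G 0 i i = G 1 i i)
    (hoff : ∀ i j, i ≠ j → G 0 i j ≤ G 1 i j) :
    (∀ s : Fin n → ℝ, (∀ i, 0 ≤ s i) →
      μ {ω | ∀ i, ℓ 0 ω i ≤ s i} ≤ μ {ω | ∀ i, ℓ 1 ω i ≤ s i}) ∧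
    (∀ x : ℝ, 0 ≤ x →
      μ {ω | x ≤ ⨆ i, ℓ 1 ω i} ≤ μ {ω | x ≤ ⨆ i, ℓ 0 ω i}) := by
  have ho : ∀ α ∈ Set.Icc (0 : ℝ) 1, ∀ i j, 0 ≤ G' α i j := by
    intro α hα i j
    refine wc_sign (fun a => G a i j) (fun a => G' a i j) (hderiv i j) (hsign i j) ?_ α hα
    by_cases hij : i = j
    · subst hij; exact (hdiag i).le
    · exact hoff i j hij
  have hd : ∀ α ∈ Set.Icc (0 : ℝ) 1, ∀ i, G' α i i = 0 := by
    intro α hα i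
    refine le_antisymm ?_ (ho α hα i i)
    have h1 := wc_sign (fun a => - G a i i) (fun a => - G' a i i)
      (fun a ha => (hderiv i i a ha).fun_neg)
      (by
        rcases hsign i i with h | h
        · right; intro a ha; simpa using h a ha
        · left; intro a ha; simpa using h a ha)
      (by show -G 0 i i ≤ -G 1 i i; rw [hdiag i]) α hα
    simpa using h1
  have hcmp : ∀ (lam : Fin n → ℝ), (∀ i, 0 ≤ lam i) → ∀ N : ℕ,
      ∫ ω, ∏ k, wcF (lam k * ℓ 0 ω k) N ∂μ ≤ ∫ ω, ∏ k, wcF (lam k * ℓ 1 ω k) N ∂μ := by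
    intro lam hlam N
    have h1 := wc_mono lam hlam G G' hderiv hinvble hMmat hpd hd ho
      (fun α => wcP μ lam (ℓ α)) (fun α _ => wcP_nn μ lam hlam (ℓ α) (hpos α))
      (fun α hα => wc_DP μ lam hlam (G α) (ℓ α) (hmeas α) (hpos α) (hperm α hα))
      (Finsupp.equivFunOnFinite.symm fun _ => N)
    rw [wc_cum μ lam hlam (ℓ 0) (hmeas 0) (hpos 0), wc_cum μ lam hlam (ℓ 1) (hmeas 1) (hpos 1)] at h1
    exact h1
  have hmain : ∀ s : Fin n → ℝ, (∀ i, 0 ≤ s i) →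
      μ {ω | ∀ i, ℓ 0 ω i ≤ s i} ≤ μ {ω | ∀ i, ℓ 1 ω i ≤ s i} := fun s hs =>
    wc_closed μ (ℓ 0) (ℓ 1) (hmeas 0) (hmeas 1) (hpos 0) (hpos 1) hcmp s hs
  refine ⟨hmain, fun x _ => ?_⟩
  have hopen := wc_open μ hn (ℓ 0) (ℓ 1) (hpos 0) hmain x
  haveI : Nonempty (Fin n) := ⟨⟨0, hn⟩⟩
  have hset : ∀ α, {ω | x ≤ ⨆ i, ℓ α ω i} = {ω | ∀ i, ℓ α ω i < x}ᶜ := by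
    intro α
    ext ω
    simp only [Set.mem_setOf_eq, Set.mem_compl_iff, not_forall, not_lt]
    constructor
    · intro h
      obtain ⟨i, hi⟩ := exists_eq_ciSup_of_finite (f := fun i => ℓ α ω i)
      exact ⟨i, by rw [hi]; exact h⟩
    · rintro ⟨i, hi⟩
      exact hi.trans (le_ciSup (Set.finite_range (fun i => ℓ α ω i)).bddAbove i)
  have hm : ∀ α, MeasurableSet {ω | ∀ i, ℓ α ω i < x} := by
    intro α
    rw [Set.setOf_forall]
    have := hmeas α
    exact MeasurableSet.iInter fun i => measurableSet_lt (by fun_prop) measurable_const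
  rw [hset 0, hset 1, prob_compl_eq_one_sub (hm 0), prob_compl_eq_one_sub (hm 1)]
  exact tsub_le_tsub_left hopen 1
end

section
/- Let {G_α : α ∈ [0,1]} be a family of n×n real matrices such that for every α, G_α is an inverse M-matrix with positive definite symmetric part, each entry α ↦ G_{α,ij} is differentiable with derivative of constant sign in α, and for each α let ℓ_α be a 1-permanental random vector with kernel G_α. Assume additionally that G₁,ᵢᵢ ≤ G₀,ᵢᵢ for all i and G₁,ᵢⱼ ≥ G₀,ᵢⱼ for all i ≠ j. Then maxᵢ ℓ₀,ᵢ stochastically dominates maxᵢ ℓ₁,ᵢ: for every x ≥ 0, P( maxᵢ ℓ₀,ᵢ ≥ x ) ≥ P( maxᵢ ℓ₁,ᵢ ≥ x ). -/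
open Matrix MeasureTheory

namespace SlepAux

open Finset in
lemma coeff_X_mul' {n : ℕ} (i : Fin n) (F : MvPowerSeries (Fin n) ℝ) (k : Fin n →₀ ℕ) :
    MvPowerSeries.coeff k (MvPowerSeries.X i * F) =
      if 0 < k i then MvPowerSeries.coeff (k - Finsupp.single i 1) F else 0 := by
  rw [MvPowerSeries.X_def, MvPowerSeries.coeff_monomial_mul]
  simp [Finsupp.single_le_iff, Nat.one_le_iff_ne_zero, Nat.pos_iff_ne_zero]

/-- Coefficientwise nonnegativity. -/
def NN {n : ℕ} (F : MvPowerSeries (Fin n) ℝ) : Prop := ∀ k, 0 ≤ MvPowerSeries.coeff k F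

lemma NN.mul {n : ℕ} {F H : MvPowerSeries (Fin n) ℝ} (hF : NN F) (hH : NN H) : NN (F * H) := by
  classical
  intro k
  rw [MvPowerSeries.coeff_mul]
  exact Finset.sum_nonneg fun p _ => mul_nonneg (hF _) (hH _)

lemma NN_X {n : ℕ} (i : Fin n) : NN (MvPowerSeries.X i : MvPowerSeries (Fin n) ℝ) := by
  classical
  intro k
  rw [MvPowerSeries.coeff_X]
  split_ifs <;> norm_num

lemma NN_C {n : ℕ} {a : ℝ} (ha : 0 ≤ a) : NN (MvPowerSeries.C a : MvPowerSeries (Fin n) ℝ) := by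
  classical
  intro k
  rw [MvPowerSeries.coeff_C]
  split_ifs <;> simp [ha]

/-- Sum of the coefficients over the box below `b`. -/
noncomputable def boxSum {n : ℕ} (b : Fin n →₀ ℕ) (F : MvPowerSeries (Fin n) ℝ) : ℝ :=
  ∑ k ∈ Finset.Iic b, MvPowerSeries.coeff k F

/-- Sum of the coefficients over a face of the box. -/
noncomputable def faceSum {n : ℕ} (b : Fin n →₀ ℕ) (i : Fin n)
    (F : MvPowerSeries (Fin n) ℝ) : ℝ :=
  ∑ k ∈ Finset.Iic b with k i = b i, MvPowerSeries.coeff k F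

lemma boxSum_X_mul {n : ℕ} (b : Fin n →₀ ℕ) (i : Fin n) (F : MvPowerSeries (Fin n) ℝ) :
    boxSum b (MvPowerSeries.X i * F) =
      if 0 < b i then boxSum (b - Finsupp.single i 1) F else 0 := by
  classical
  unfold boxSum
  simp_rw [coeff_X_mul']
  rw [← Finset.sum_filter]
  split_ifs with hb
  · refine Finset.sum_nbij' (fun k => k - Finsupp.single i 1) (fun k => k + Finsupp.single i 1)
      ?_ ?_ ?_ ?_ ?_
    · intro k hk
      simp only [Finset.mem_filter, Finset.mem_Iic] at hk ⊢
      exact tsub_le_tsub_right hk.1 _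
    · intro k hk
      simp only [Finset.mem_filter, Finset.mem_Iic] at hk ⊢
      refine ⟨?_, by simp⟩
      rwa [← le_tsub_iff_right]
      simpa using Nat.one_le_iff_ne_zero.mpr hb.ne'
    · intro k hk
      simp only [Finset.mem_filter, Finset.mem_Iic] at hk
      refine tsub_add_cancel_of_le ?_
      simpa using Nat.one_le_iff_ne_zero.mpr hk.2.ne'
    · intro k hk
      simp
    · intro k hk
      rfl
  · refine Finset.sum_eq_zero fun k hk => ?_
    simp only [Finset.mem_filter, Finset.mem_Iic] at hk
    exact absurd (lt_of_lt_of_le hk.2 (hk.1 i)) hb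

lemma boxSum_one_sub_X_mul {n : ℕ} (b : Fin n →₀ ℕ) (i : Fin n) (F : MvPowerSeries (Fin n) ℝ) :
    boxSum b ((1 - MvPowerSeries.X i) * F) = faceSum b i F := by
  classical
  have h1 : boxSum b ((1 - MvPowerSeries.X i) * F) =
      boxSum b F - boxSum b (MvPowerSeries.X i * F) := by
    unfold boxSum
    rw [sub_mul, one_mul, ← Finset.sum_sub_distrib]
    simp
  have h2 : boxSum b F = faceSum b i F +
      ∑ k ∈ Finset.Iic b with ¬ k i = b i, MvPowerSeries.coeff k F := by
    unfold boxSum faceSum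
    rw [Finset.sum_filter_add_sum_filter_not]
  have h3 : boxSum b (MvPowerSeries.X i * F) =
      ∑ k ∈ Finset.Iic b with ¬ k i = b i, MvPowerSeries.coeff k F := by
    rw [boxSum_X_mul]
    split_ifs with hb
    · unfold boxSum
      refine Finset.sum_congr ?_ fun _ _ => rfl
      ext k
      simp only [Finset.mem_filter, Finset.mem_Iic]
      constructor
      · intro h
        refine ⟨h.trans tsub_le_self, ?_⟩
        have := h i
        simp at this
        omega
      · rintro ⟨h, h'⟩ j
        have := h j
        by_cases hj : j = i
        · subst hj
          simp
          omega
        · simpa [Finsupp.single_apply, Ne.symm hj] using this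
    · symm
      refine Finset.sum_eq_zero fun k hk => ?_
      simp only [Finset.mem_filter, Finset.mem_Iic] at hk
      have := hk.1 i
      omega
  rw [h1, h2, h3]; ring

/-- The contraction lemma. -/
lemma faceSum_one_sub_mul_nonneg {n : ℕ} (b : Fin n →₀ ℕ) (i : Fin n)
    (Q F : MvPowerSeries (Fin n) ℝ) (hQ : NN Q) (hF : NN F)
    (hQ1 : boxSum b Q ≤ 1) (hQi : ∀ k : Fin n →₀ ℕ, 0 < k i → MvPowerSeries.coeff k Q = 0) :
    0 ≤ faceSum b i ((1 - Q) * F) := by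
  classical
  have h1 : faceSum b i ((1 - Q) * F) = faceSum b i F - faceSum b i (Q * F) := by
    unfold faceSum
    rw [sub_mul, one_mul, ← Finset.sum_sub_distrib]
    simp
  have h2 : faceSum b i (Q * F) ≤ boxSum b Q * faceSum b i F := by
    unfold faceSum boxSum
    simp_rw [MvPowerSeries.coeff_mul]
    rw [Finset.sum_mul_sum, ← Finset.sum_product', Finset.sum_sigma']
    rw [← Finset.sum_filter_of_ne (p := fun x : (_ : Fin n →₀ ℕ) × (Fin n →₀ ℕ) × (Fin n →₀ ℕ) =>
      x.2.1 i = 0)]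
    · rw [← Finset.sum_image (s := Finset.filter _ _)
        (f := fun x : (Fin n →₀ ℕ) × (Fin n →₀ ℕ) =>
          MvPowerSeries.coeff x.1 Q * MvPowerSeries.coeff x.2 F) (g := fun x : (_ : Fin n →₀ ℕ) × (Fin n →₀ ℕ) × (Fin n →₀ ℕ) => x.2)]
      · refine Finset.sum_le_sum_of_subset_of_nonneg ?_ ?_
        · intro p hp
          simp only [Finset.mem_image, Finset.mem_filter, Finset.mem_sigma, Finset.mem_Iic,
            Finset.mem_product] at hp ⊢
          obtain ⟨x, ⟨⟨⟨h1, h2⟩, h3⟩, h4⟩, rfl⟩ := hp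
          rw [Finset.HasAntidiagonal.mem_antidiagonal] at h3
          have h5 : x.2.1 i + x.2.2 i = x.1 i := by rw [← h3]; rfl
          refine ⟨?_, ?_, by omega⟩
          · exact le_trans (by rw [← h3]; exact le_self_add) h1
          · exact le_trans (by rw [← h3]; exact le_add_self) h1
        · intro p _ _
          exact mul_nonneg (hQ _) (hF _)
      · intro x hx y hy hxy
        simp only [Finset.coe_filter, Finset.mem_sigma, Finset.mem_filter, Finset.mem_Iic,
            Set.mem_ofPred_eq] at hx hy
        obtain ⟨x1, x2⟩ := x
        obtain ⟨y1, y2⟩ := y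
        simp only at hx hy hxy
        subst hxy
        have : x1 = y1 := by
          rw [← Finset.HasAntidiagonal.mem_antidiagonal.mp hx.1.2, ← Finset.HasAntidiagonal.mem_antidiagonal.mp hy.1.2]
        subst this
        rfl
    · intro x _ hx
      by_contra h
      exact hx (by rw [hQi _ (Nat.pos_of_ne_zero h), zero_mul])
  have h3 : 0 ≤ faceSum b i F := Finset.sum_nonneg fun k _ => hF k
  rw [h1]
  nlinarith

lemma boxSum_X_le {n : ℕ} (b : Fin n →₀ ℕ) (i : Fin n) :
    boxSum b (MvPowerSeries.X i) ≤ 1 := by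
  classical
  unfold boxSum
  simp_rw [MvPowerSeries.coeff_X]
  rw [Finset.sum_ite_eq']
  split_ifs <;> norm_num

/-- Resolvent-type series. -/
lemma resolvent_facts {n : ℕ} (B : Matrix (Fin n) (Fin n) ℝ) (hB : ∀ i j, 0 ≤ B i j) (θ : ℝ)
    (hθ : 0 ≤ θ) (e : Fin n → ℝ) (he : ∀ i, 0 ≤ e i)
    (j : Fin n) (Y : Fin n → MvPowerSeries (Fin n) ℝ)
    (hY : ∀ i, Y i = MvPowerSeries.C (B i j) +
      ∑ l, MvPowerSeries.C (θ * B i l * e l) * (MvPowerSeries.X l * Y l)) :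
    (∀ i, NN (Y i)) ∧
    (∀ m, e m = 0 → ∀ i, ∀ k : Fin n →₀ ℕ, 0 < k m → MvPowerSeries.coeff k (Y i) = 0) ∧
    (∀ v : Fin n → ℝ, (∀ i, 0 ≤ v i) → (∀ i, B i j + ∑ l, θ * B i l * e l * v l ≤ v i) →
      ∀ b i, boxSum b (Y i) ≤ v i) := by
  classical
  have key : ∀ i k, MvPowerSeries.coeff k (Y i) = (if k = 0 then B i j else 0) +
      ∑ l, θ * B i l * e l *
        (if 0 < k l then MvPowerSeries.coeff (k - Finsupp.single l 1) (Y l) else 0) := by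
    intro i k
    conv_lhs => rw [hY i]
    simp only [map_add, map_sum, MvPowerSeries.coeff_C_mul, coeff_X_mul', MvPowerSeries.coeff_C]
  have lt : ∀ (k : Fin n →₀ ℕ) (l : Fin n), 0 < k l → k - Finsupp.single l 1 < k := by
    intro k l h
    refine lt_of_le_of_ne tsub_le_self fun h' => ?_
    have := DFunLike.congr_fun h' l
    simp at this
    omega
  refine ⟨?_, ?_, ?_⟩
  · intro i k
    induction k using WellFoundedLT.induction generalizing i with
    | ind k ih =>
      rw [key]
      refine add_nonneg (by split_ifs <;> simp [hB]) (Finset.sum_nonneg fun l _ => ?_)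
      refine mul_nonneg (mul_nonneg (mul_nonneg hθ (hB _ _)) (he _)) ?_
      split_ifs with h
      · exact ih _ (lt k l h) l
      · exact le_rfl
  · intro m hm i k
    induction k using WellFoundedLT.induction generalizing i with
    | ind k ih =>
      intro hk
      rw [key, if_neg (by rintro rfl; simp at hk), zero_add]
      refine Finset.sum_eq_zero fun l _ => ?_
      by_cases hl : l = m
      · subst hl; simp [hm]
      · split_ifs with h
        · rw [ih _ (lt k l h) l (by simpa [Finsupp.single_apply, hl] using hk), mul_zero]
        · simp
  · intro v hv hvB b
    induction b using WellFoundedLT.induction with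
    | ind b ih =>
      intro i
      have : boxSum b (Y i) = B i j + ∑ l, θ * B i l * e l *
          (if 0 < b l then boxSum (b - Finsupp.single l 1) (Y l) else 0) := by
        simp_rw [← boxSum_X_mul]
        unfold boxSum
        conv_lhs => rw [hY i]
        simp only [map_add, map_sum, MvPowerSeries.coeff_C_mul, MvPowerSeries.coeff_C,
          Finset.sum_add_distrib]
        rw [Finset.sum_comm]
        simp [Finset.mul_sum]
      rw [this]
      refine le_trans ?_ (hvB i)
      gcongr with l
      · exact mul_nonneg (mul_nonneg hθ (hB _ _)) (he _)
      · split_ifs with h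
        · exact ih _ (lt b l h) l
        · exact hv l

end SlepAux

namespace SlepAux

structure Good {n : ℕ} (G : Matrix (Fin n) (Fin n) ℝ) : Prop where
  nn : ∀ i j, 0 ≤ G i j
  unit : IsUnit G.det
  zmat : ∀ i j, i ≠ j → G⁻¹ i j ≤ 0
  pd : ∀ x : Fin n → ℝ, x ≠ 0 → 0 < x ⬝ᵥ G.mulVec x

lemma isUnit_det_of_pd {n : ℕ} {A : Matrix (Fin n) (Fin n) ℝ}
    (h : ∀ x : Fin n → ℝ, x ≠ 0 → 0 < x ⬝ᵥ A.mulVec x) : IsUnit A.det := by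
  rw [isUnit_iff_ne_zero]
  intro h0
  obtain ⟨v, hv, hv'⟩ := Matrix.exists_mulVec_eq_zero_iff.mpr h0
  have := h v hv
  rw [hv'] at this
  simp at this

lemma Good.inv_pd {n : ℕ} {G : Matrix (Fin n) (Fin n) ℝ} (hG : Good G) (x : Fin n → ℝ)
    (hx : x ≠ 0) : 0 < x ⬝ᵥ G⁻¹.mulVec x := by
  have h1 : G.mulVec (G⁻¹.mulVec x) = x := by
    rw [Matrix.mulVec_mulVec, Matrix.mul_nonsing_inv _ hG.unit, Matrix.one_mulVec]
  have h2 : G⁻¹.mulVec x ≠ 0 := by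
    intro h; rw [h] at h1; simp at h1; exact hx h1.symm
  have := hG.pd _ h2
  rw [h1, dotProduct_comm] at this
  exact this

lemma Good.add_diag_pd {n : ℕ} {G : Matrix (Fin n) (Fin n) ℝ} (hG : Good G) (lam : Fin n → ℝ)
    (hl : ∀ i, 0 ≤ lam i) (x : Fin n → ℝ)
    (hx : x ≠ 0) : 0 < x ⬝ᵥ (G⁻¹ + Matrix.diagonal lam).mulVec x := by
  rw [Matrix.add_mulVec, dotProduct_add]
  refine add_pos_of_pos_of_nonneg (hG.inv_pd x hx) ?_
  unfold dotProduct
  refine Finset.sum_nonneg fun i _ => ?_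
  rw [Matrix.mulVec_diagonal]
  nlinarith [mul_nonneg (hl i) (mul_self_nonneg (x i))]

lemma Good.det_ne {n : ℕ} {G : Matrix (Fin n) (Fin n) ℝ} (hG : Good G) (lam : Fin n → ℝ)
    (hl : ∀ i, 0 ≤ lam i) : (1 + Matrix.diagonal lam * G).det ≠ 0 := by
  have h : 1 + Matrix.diagonal lam * G = (G⁻¹ + Matrix.diagonal lam) * G := by
    rw [add_mul, Matrix.nonsing_inv_mul _ hG.unit]
  rw [h, Matrix.det_mul]
  exact mul_ne_zero (isUnit_det_of_pd (hG.add_diag_pd lam hl)).ne_zero hG.unit.ne_zero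

lemma zmat_nonneg {n : ℕ} {A : Matrix (Fin n) (Fin n) ℝ} (hz : ∀ i j, i ≠ j → A i j ≤ 0)
    (h : ∀ x : Fin n → ℝ, x ≠ 0 → 0 < x ⬝ᵥ A.mulVec x) (v : Fin n → ℝ)
    (hv : ∀ i, 0 ≤ A.mulVec v i) : ∀ i, 0 ≤ v i := by
  set p : Fin n → ℝ := fun i => max (v i) 0 with hp
  set m : Fin n → ℝ := fun i => max (-v i) 0 with hm
  have hvpm : v = p - m := by
    ext i
    simp only [hp, hm, Pi.sub_apply]
    rcases le_total (v i) 0 with h | h <;> simp [h]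
  have hm0 : m = 0 := by
    by_contra hne
    have h1 := h m hne
    have h2 : 0 ≤ m ⬝ᵥ A.mulVec v :=
      Finset.sum_nonneg fun i _ => mul_nonneg (le_max_right _ _) (hv i)
    have h3 : m ⬝ᵥ A.mulVec p ≤ 0 := by
      unfold dotProduct Matrix.mulVec dotProduct
      refine Finset.sum_nonpos fun i _ => ?_
      rw [Finset.mul_sum]
      refine Finset.sum_nonpos fun j _ => ?_
      by_cases hij : i = j
      · subst hij
        have : m i * p i = 0 := by
          simp only [hp, hm]
          rcases le_total (v i) 0 with h | h <;> simp [h]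
        refine le_of_eq ?_
        linear_combination (A i i) * this
      · have h4 : 0 ≤ m i * p j := mul_nonneg (le_max_right _ _) (le_max_right _ _)
        nlinarith [hz i j hij]
    rw [hvpm, Matrix.mulVec_sub, dotProduct_sub] at h2
    linarith
  intro i
  have := congrFun hm0 i
  simp only [hm, Pi.zero_apply] at this
  have := le_max_left (-v i) 0
  linarith

/-- The matrix `G⁻¹ + θ`. -/
noncomputable abbrev Tm {n : ℕ} (G : Matrix (Fin n) (Fin n) ℝ) (θ : ℝ) :
    Matrix (Fin n) (Fin n) ℝ := G⁻¹ + Matrix.diagonal (fun _ => θ)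

lemma Good.res {n : ℕ} {G : Matrix (Fin n) (Fin n) ℝ} (hG : Good G) (θ : ℝ) (hθ : 0 ≤ θ) :
    IsUnit (Tm G θ).det ∧
    ∀ i j, 0 ≤ (Tm G θ)⁻¹ i j := by
  have hu := isUnit_det_of_pd (hG.add_diag_pd (fun _ => θ) (fun _ => hθ))
  refine ⟨hu, fun i j => ?_⟩
  have := zmat_nonneg (A := Tm G θ) (fun i j hij => by
    simpa [Matrix.diagonal_apply, hij] using hG.zmat i j hij)
    (hG.add_diag_pd (fun _ => θ) (fun _ => hθ))
    ((Tm G θ)⁻¹.mulVec (Pi.single j 1)) (fun k => by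
      rw [Matrix.mulVec_mulVec, Matrix.mul_nonsing_inv _ hu, Matrix.one_mulVec]
      by_cases hk : k = j
      · subst hk; simp
      · simp [hk]) i
  simpa [Matrix.mulVec_single] using this

/-- The diagonal series `θ (1 - X_i)`. -/
noncomputable def dser {n : ℕ} (θ : ℝ) (i : Fin n) : MvPowerSeries (Fin n) ℝ :=
  MvPowerSeries.C θ * (1 - MvPowerSeries.X i)

noncomputable def Wm {n : ℕ} (θ : ℝ) (G : Matrix (Fin n) (Fin n) ℝ) :
    Matrix (Fin n) (Fin n) (MvPowerSeries (Fin n) ℝ) :=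
  1 + Matrix.diagonal (dser θ) * G.map MvPowerSeries.C

noncomputable def Km {n : ℕ} (θ : ℝ) (G : Matrix (Fin n) (Fin n) ℝ) (e : Fin n → ℝ) :
    Matrix (Fin n) (Fin n) (MvPowerSeries (Fin n) ℝ) :=
  G⁻¹.map MvPowerSeries.C + Matrix.diagonal
    (fun l => MvPowerSeries.C θ * (1 - MvPowerSeries.C (e l) * MvPowerSeries.X l))

lemma Km_isUnit {n : ℕ} {G : Matrix (Fin n) (Fin n) ℝ} (hG : Good G) (θ : ℝ) (hθ : 0 ≤ θ)
    (e : Fin n → ℝ) : IsUnit (Km θ G e).det := by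
  rw [MvPowerSeries.isUnit_iff_constantCoeff, RingHom.map_det]
  have h : MvPowerSeries.constantCoeff.mapMatrix (Km θ G e) = Tm G θ := by
    apply Matrix.ext
    intro i j
    by_cases hij : i = j
    · subst hij; simp [Km]
    · simp [Km, hij]
  rw [h]
  exact (hG.res θ hθ).1

lemma Km_inv_eq {n : ℕ} {G : Matrix (Fin n) (Fin n) ℝ} (hG : Good G) (θ : ℝ) (hθ : 0 ≤ θ)
    (e : Fin n → ℝ) (i j : Fin n) :
    (Km θ G e)⁻¹ i j = MvPowerSeries.C ((Tm G θ)⁻¹ i j) +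
      ∑ l, MvPowerSeries.C (θ * (Tm G θ)⁻¹ i l * e l) *
        (MvPowerSeries.X l * (Km θ G e)⁻¹ l j) := by
  set T := Tm G θ with hT
  set Y := (Km θ G e)⁻¹ with hY
  set D : Matrix (Fin n) (Fin n) (MvPowerSeries (Fin n) ℝ) := Matrix.diagonal
    (fun l => MvPowerSeries.C (θ * e l) * MvPowerSeries.X l) with hD
  have h1 : Km θ G e = T.map MvPowerSeries.C - D := by
    ext1 a c
    by_cases hac : a = c
    · subst hac; simp [Km, hT, hD]; ring
    · simp [Km, hT, hD, hac]
  have h2 : T⁻¹.map MvPowerSeries.C * T.map MvPowerSeries.C =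
      (1 : Matrix (Fin n) (Fin n) (MvPowerSeries (Fin n) ℝ)) := by
    rw [← Matrix.map_mul, Matrix.nonsing_inv_mul _ (hG.res θ hθ).1]
    simp
  have h3 : Km θ G e * Y = 1 := Matrix.mul_nonsing_inv _ (Km_isUnit hG θ hθ e)
  have h4 : Y = T⁻¹.map MvPowerSeries.C + T⁻¹.map MvPowerSeries.C * D * Y := by
    have : T⁻¹.map MvPowerSeries.C * (Km θ G e * Y) = T⁻¹.map MvPowerSeries.C := by
      rw [h3, mul_one]
    rw [h1, sub_mul, mul_sub, ← mul_assoc, h2, one_mul, ← mul_assoc] at this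
    exact eq_add_of_sub_eq this
  conv_lhs => rw [h4]
  rw [Matrix.add_apply, Matrix.map_apply, Matrix.mul_apply]
  simp only [hD, Matrix.mul_diagonal, Matrix.map_apply]
  congr 1
  refine Finset.sum_congr rfl fun l _ => ?_
  simp only [map_mul]
  ring

lemma Wm_inv {n : ℕ} {G : Matrix (Fin n) (Fin n) ℝ} (hG : Good G) (θ : ℝ) (hθ : 0 ≤ θ) :
    Wm θ G * (1 - Matrix.diagonal (dser θ) * (Km θ G 1)⁻¹) = 1 := by
  have hK : Km θ G 1 = G⁻¹.map MvPowerSeries.C + Matrix.diagonal (dser θ) := by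
    unfold Km dser; simp
  have h2 : G.map MvPowerSeries.C * G⁻¹.map MvPowerSeries.C =
      (1 : Matrix (Fin n) (Fin n) (MvPowerSeries (Fin n) ℝ)) := by
    rw [← Matrix.map_mul, Matrix.mul_nonsing_inv _ hG.unit]
    simp
  have h2' : G⁻¹.map MvPowerSeries.C * G.map MvPowerSeries.C =
      (1 : Matrix (Fin n) (Fin n) (MvPowerSeries (Fin n) ℝ)) := by
    rw [← Matrix.map_mul, Matrix.nonsing_inv_mul _ hG.unit]
    simp
  have h3 : Km θ G 1 * (Km θ G 1)⁻¹ = 1 := Matrix.mul_nonsing_inv _ (Km_isUnit hG θ hθ 1)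
  have h4 : Wm θ G = Km θ G 1 * G.map MvPowerSeries.C := by
    rw [hK, add_mul, h2']; rfl
  have h5 : 1 - Matrix.diagonal (dser θ) * (Km θ G 1)⁻¹ =
      G⁻¹.map MvPowerSeries.C * (Km θ G 1)⁻¹ := by
    rw [sub_eq_iff_eq_add, ← add_mul, ← hK, h3]
  rw [h4, h5, mul_assoc, ← mul_assoc (G.map _), h2, one_mul, h3]

lemma offdiag_sign {n : ℕ} {G : Matrix (Fin n) (Fin n) ℝ} (hG : Good G) (θ : ℝ) (hθ : 0 ≤ θ)
    (φ : MvPowerSeries (Fin n) ℝ) (hφ : NN φ) (b : Fin n →₀ ℕ) (i j : Fin n) (hij : i ≠ j) :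
    boxSum b (φ * (dser θ i *
      (1 - Matrix.diagonal (dser θ) * (Km θ G 1)⁻¹ : Matrix _ _ _) j i)) ≤ 0 := by
  have hR := (resolvent_facts _ (hG.res θ hθ).2 θ hθ 1 (fun _ => zero_le_one) i
    (fun l => (Km θ G 1)⁻¹ l i) (fun l => Km_inv_eq hG θ hθ 1 l i)).1 j
  set F : MvPowerSeries (Fin n) ℝ :=
    MvPowerSeries.C (θ * θ) * (φ * (Km θ G 1)⁻¹ j i) with hF
  have hFn : NN F := (NN_C (mul_nonneg hθ hθ)).mul (hφ.mul hR)
  have e : φ * (dser θ i * (1 - Matrix.diagonal (dser θ) * (Km θ G 1)⁻¹ : Matrix _ _ _) j i) =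
      - ((1 - MvPowerSeries.X i) * ((1 - MvPowerSeries.X j) * F)) := by
    simp only [Matrix.sub_apply, Matrix.one_apply_ne hij.symm, Matrix.diagonal_mul, dser, hF,
      map_mul]
    ring
  have h := faceSum_one_sub_mul_nonneg b i (MvPowerSeries.X j) F (NN_X j) hFn (boxSum_X_le b j)
    (fun k hk => by
      classical
      rw [MvPowerSeries.coeff_X, if_neg]
      rintro rfl
      simp [hij] at hk)
  rw [← boxSum_one_sub_X_mul] at h
  rw [e]
  unfold boxSum at h ⊢
  simp only [map_neg, Finset.sum_neg_distrib]
  linarith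

lemma diag_sign {n : ℕ} {G : Matrix (Fin n) (Fin n) ℝ} (hG : Good G) (θ : ℝ) (hθ : 0 ≤ θ)
    (φ : MvPowerSeries (Fin n) ℝ) (hφ : NN φ) (b : Fin n →₀ ℕ) (i : Fin n) :
    0 ≤ boxSum b (φ * (dser θ i *
      (1 - Matrix.diagonal (dser θ) * (Km θ G 1)⁻¹ : Matrix _ _ _) i i)) := by
  set e : Fin n → ℝ := fun l => if l = i then 0 else 1 with he
  have he0 : ∀ l, 0 ≤ e l := fun l => by simp only [he]; split_ifs <;> norm_num
  set B := (Tm G θ)⁻¹ with hB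
  have hg : 0 ≤ G i i := hG.nn i i
  have hpos : 0 < 1 + θ * G i i := by positivity
  obtain ⟨hR1, hR2, hR3⟩ := resolvent_facts _ (hG.res θ hθ).2 θ hθ e he0 i
    (fun l => (Km θ G e)⁻¹ l i) (fun l => Km_inv_eq hG θ hθ e l i)
  set r := MvPowerSeries.C θ * (Km θ G 1)⁻¹ i i with hr
  set q := MvPowerSeries.C θ * (Km θ G e)⁻¹ i i with hq
  have hqn : NN q := (NN_C hθ).mul (hR1 i)
  have hqi : ∀ k : Fin n →₀ ℕ, 0 < k i → MvPowerSeries.coeff k q = 0 := by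
    intro k hk
    rw [hq, MvPowerSeries.coeff_C_mul, hR2 i (by simp [he]) i k hk, mul_zero]
  have hq1 : boxSum b q ≤ 1 := by
    have h := hR3 (fun l => G l i / (1 + θ * G i i)) (fun l => div_nonneg (hG.nn l i) hpos.le)
      (fun l => by
        have hv : (Tm G θ).mulVec
            (fun l => G l i / (1 + θ * G i i)) =
            fun l => (if l = i then 1 else 0) + θ * e l * (G l i / (1 + θ * G i i)) := by
          have h0 : G⁻¹.mulVec (fun l => G l i / (1 + θ * G i i)) =
              fun l => (if l = i then 1 else 0) / (1 + θ * G i i) := by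
            ext l
            have h1 := congrFun (congrFun (Matrix.nonsing_inv_mul G hG.unit) l) i
            rw [Matrix.mul_apply, Matrix.one_apply] at h1
            rw [← h1, Finset.sum_div]
            simp [Matrix.mulVec, dotProduct, mul_div_assoc]
          rw [Matrix.add_mulVec, h0]
          ext l
          rw [Pi.add_apply, Matrix.mulVec_diagonal]
          by_cases hl : l = i
          · subst hl; simp [he]; field_simp
          · simp [he, hl]
        have h1 : B.mulVec ((Tm G θ).mulVec
            (fun l => G l i / (1 + θ * G i i))) = fun l => G l i / (1 + θ * G i i) := by
          rw [Matrix.mulVec_mulVec, hB, Matrix.nonsing_inv_mul _ (hG.res θ hθ).1,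
            Matrix.one_mulVec]
        rw [hv] at h1
        have h2 := congrFun h1 l
        refine le_of_eq ?_
        rw [← h2]
        simp only [Matrix.mulVec, dotProduct, mul_add, Finset.sum_add_distrib]
        congr 1
        · simp [hB]
        · refine Finset.sum_congr rfl fun m _ => ?_
          ring) b i
    have h' : boxSum b q = θ * boxSum b ((Km θ G e)⁻¹ i i) := by
      unfold boxSum
      simp [hq, Finset.mul_sum]
    rw [h']
    calc θ * boxSum b ((Km θ G e)⁻¹ i i) ≤ θ * (G i i / (1 + θ * G i i)) := by gcongr
      _ ≤ 1 := by
        rw [← mul_div_assoc, div_le_one hpos]; linarith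
  have hrel : r * (1 - q * MvPowerSeries.X i) = q := by
    have hK : Km θ G e = Km θ G 1 + (MvPowerSeries.C θ : MvPowerSeries (Fin n) ℝ) •
        Matrix.single i i (MvPowerSeries.X i : MvPowerSeries (Fin n) ℝ) := by
      ext1 a c
      by_cases hac : a = c
      · subst hac
        by_cases ha : a = i
        · subst ha; simp [Km, he]; ring
        · simp [Km, he, ha, Matrix.single_apply, Ne.symm ha]
      · have : ¬ (i = a ∧ i = c) := by rintro ⟨rfl, rfl⟩; exact hac rfl
        simp [Km, hac, Matrix.single_apply, this]
    have h1 : (Km θ G 1)⁻¹ * Km θ G e * (Km θ G e)⁻¹ = (Km θ G 1)⁻¹ := by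
      rw [mul_assoc, Matrix.mul_nonsing_inv _ (Km_isUnit hG θ hθ e), mul_one]
    conv at h1 => lhs; lhs; rw [hK, mul_add, Matrix.nonsing_inv_mul _ (Km_isUnit hG θ hθ 1)]
    have h2 := congrFun (congrFun h1 i) i
    rw [add_mul, one_mul, Matrix.add_apply, Matrix.mul_smul, Matrix.smul_mul, Matrix.smul_apply,
      Matrix.mul_apply] at h2
    rw [Finset.sum_eq_single i (fun m _ hm => by
      rw [Matrix.mul_single_apply_of_ne _ _ _ _ _ hm, zero_mul]) (by simp),
      Matrix.mul_single_apply_same] at h2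
    rw [smul_eq_mul] at h2
    rw [hr, hq]
    linear_combination (-MvPowerSeries.C θ) * h2
  have hu : MvPowerSeries.constantCoeff (1 - q * MvPowerSeries.X i) ≠ 0 := by simp
  set H := (1 - q * MvPowerSeries.X i : MvPowerSeries (Fin n) ℝ)⁻¹ with hH
  have hHm : (1 - q * MvPowerSeries.X i) * H = 1 := MvPowerSeries.mul_inv_cancel _ hu
  have hHn : NN H := by
    intro k
    induction k using WellFoundedLT.induction with
    | ind k ih =>
      classical
      have h1 : H = 1 + MvPowerSeries.X i * (q * H) := by linear_combination hHm
      rw [h1, map_add, coeff_X_mul']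
      refine add_nonneg (by rw [MvPowerSeries.coeff_one]; split_ifs <;> norm_num) ?_
      split_ifs with hk
      · rw [MvPowerSeries.coeff_mul]
        refine Finset.sum_nonneg fun p hp => mul_nonneg (hqn _) (ih _ ?_)
        rw [Finset.HasAntidiagonal.mem_antidiagonal] at hp
        have h2 : p.2 ≤ k - Finsupp.single i 1 := by rw [← hp]; exact le_add_self
        refine lt_of_le_of_lt h2 (lt_of_le_of_ne tsub_le_self fun h' => ?_)
        have := DFunLike.congr_fun h' i
        simp at this
        omega
      · exact le_rfl
  have hfin : φ * (dser θ i * (1 - Matrix.diagonal (dser θ) * (Km θ G 1)⁻¹ : Matrix _ _ _) i i) =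
      (1 - MvPowerSeries.X i) * ((1 - q) * (MvPowerSeries.C θ * (φ * H))) := by
    have h1 : (1 - Matrix.diagonal (dser θ) * (Km θ G 1)⁻¹ : Matrix _ _ _) i i =
        1 - (1 - MvPowerSeries.X i) * r := by
      simp only [Matrix.sub_apply, Matrix.one_apply_eq, Matrix.diagonal_mul, dser, hr]
      ring
    have h2 : 1 - (1 - MvPowerSeries.X i) * r = (1 - q) * H := by
      have h3 : (1 - (1 - MvPowerSeries.X i) * r) * (1 - q * MvPowerSeries.X i) = 1 - q := by
        linear_combination (-(1 - MvPowerSeries.X i)) * hrel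
      linear_combination H * h3 - (1 - (1 - MvPowerSeries.X i) * r) * hHm
    rw [h1, h2, dser]
    ring
  rw [hfin, boxSum_one_sub_X_mul]
  exact faceSum_one_sub_mul_nonneg b i q _ hqn ((NN_C hθ).mul (hφ.mul hHn)) hq1 hqi

end SlepAux

namespace SlepAux

/-- Coefficientwise differentiability. -/
def HD {n : ℕ} (F : ℝ → MvPowerSeries (Fin n) ℝ) (F' : MvPowerSeries (Fin n) ℝ) (s : Set ℝ)
    (α : ℝ) : Prop :=
  ∀ k, HasDerivWithinAt (fun a => MvPowerSeries.coeff k (F a)) (MvPowerSeries.coeff k F') s α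

lemma HD.mul {n : ℕ} {F H : ℝ → MvPowerSeries (Fin n) ℝ} {F' H' : MvPowerSeries (Fin n) ℝ}
    {s : Set ℝ} {α : ℝ} (hF : HD F F' s α) (hH : HD H H' s α) :
    HD (fun a => F a * H a) (F' * H α + F α * H') s α := by
  classical
  intro k
  simp only [map_add, MvPowerSeries.coeff_mul, ← Finset.sum_add_distrib]
  exact HasDerivWithinAt.fun_sum fun p _ => (hF p.1).mul (hH p.2)

lemma HD_const {n : ℕ} (F : MvPowerSeries (Fin n) ℝ) (s : Set ℝ) (α : ℝ) :
    HD (fun _ => F) 0 s α := by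
  intro k
  simpa using hasDerivWithinAt_const α s (MvPowerSeries.coeff k F)

lemma HD.sum {n : ℕ} {ι : Type*} (t : Finset ι) {F : ι → ℝ → MvPowerSeries (Fin n) ℝ}
    {F' : ι → MvPowerSeries (Fin n) ℝ} {s : Set ℝ} {α : ℝ} (hF : ∀ i ∈ t, HD (F i) (F' i) s α) :
    HD (fun a => ∑ i ∈ t, F i a) (∑ i ∈ t, F' i) s α := by
  intro k
  simp only [map_sum]
  exact HasDerivWithinAt.fun_sum fun p hp => hF p hp k

lemma HD.prod {n : ℕ} {ι : Type*} [DecidableEq ι] (t : Finset ι)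
    {F : ι → ℝ → MvPowerSeries (Fin n) ℝ}
    {F' : ι → MvPowerSeries (Fin n) ℝ} {s : Set ℝ} {α : ℝ} (hF : ∀ i ∈ t, HD (F i) (F' i) s α) :
    HD (fun a => ∏ i ∈ t, F i a) (∑ i ∈ t, F' i * ∏ j ∈ t.erase i, F j α) s α := by
  induction t using Finset.induction_on with
  | empty => simpa using HD_const 1 s α
  | insert i t hi ih =>
    have h := (hF i (Finset.mem_insert_self _ _)).mul
      (ih fun j hj => hF j (Finset.mem_insert_of_mem hj))
    simp only [Finset.prod_insert hi, Finset.sum_insert hi, Finset.erase_insert hi]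
    convert h using 2
    rw [Finset.mul_sum]
    refine Finset.sum_congr rfl fun j hj => ?_
    have hne : i ≠ j := by rintro rfl; exact hi hj
    rw [Finset.erase_insert_of_ne hne, Finset.prod_insert (by simp [hi])]
    ring

lemma HD.det {n : ℕ} {W : ℝ → Matrix (Fin n) (Fin n) (MvPowerSeries (Fin n) ℝ)}
    {W' : Matrix (Fin n) (Fin n) (MvPowerSeries (Fin n) ℝ)} {s : Set ℝ} {α : ℝ}
    (hW : ∀ i j, HD (fun a => W a i j) (W' i j) s α) :
    HD (fun a => (W a).det) (∑ i, ∑ j, (W α).adjugate i j * W' j i) s α := by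
  have h1 : ∑ i, ∑ j, (W α).adjugate i j * W' j i =
      ∑ σ : Equiv.Perm (Fin n), ((Equiv.Perm.sign σ : ℤ) : MvPowerSeries (Fin n) ℝ) *
        ∑ i, W' (σ i) i * ∏ j ∈ Finset.univ.erase i, W α (σ j) j := by
    have : ∀ i, ∑ j, (W α).adjugate i j * W' j i =
        ∑ σ : Equiv.Perm (Fin n), ((Equiv.Perm.sign σ : ℤ) : MvPowerSeries (Fin n) ℝ) *
        (W' (σ i) i * ∏ j ∈ Finset.univ.erase i, W α (σ j) j) := by
      intro i
      have h := congrFun (Matrix.cramer_eq_adjugate_mulVec (W α) (fun j => W' j i)) i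
      rw [Matrix.cramer_apply, Matrix.det_apply'] at h
      rw [show ∑ j, (W α).adjugate i j * W' j i =
        ((W α).adjugate.mulVec fun j => W' j i) i from rfl, ← h]
      refine Finset.sum_congr rfl fun σ _ => ?_
      congr 1
      rw [← Finset.mul_prod_erase _ _ (Finset.mem_univ i)]
      congr 1
      · simp
      · refine Finset.prod_congr rfl fun j hj => ?_
        rw [Matrix.updateCol_ne (Finset.ne_of_mem_erase hj)]
    simp_rw [this]
    rw [Finset.sum_comm]
    simp_rw [Finset.mul_sum]
  rw [h1]
  simp_rw [Matrix.det_apply']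
  refine HD.sum _ fun σ _ => ?_
  have := (HD_const ((Equiv.Perm.sign σ : ℤ) : MvPowerSeries (Fin n) ℝ) s α).mul
    (HD.prod Finset.univ (F := fun i a => W a (σ i) i) (F' := fun i => W' (σ i) i)
      (fun i _ => hW _ _))
  simpa using this

lemma HD.inv {n : ℕ} {P : ℝ → MvPowerSeries (Fin n) ℝ} {P' : MvPowerSeries (Fin n) ℝ}
    {s : Set ℝ} {α : ℝ} (hs : UniqueDiffWithinAt ℝ s α) (hα : α ∈ s)
    (h0 : ∀ a ∈ s, MvPowerSeries.constantCoeff (P a) ≠ 0) (hP : HD P P' s α) :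
    HD (fun a => (P a)⁻¹) (-((P α)⁻¹ * ((P α)⁻¹ * P'))) s α := by
  classical
  have hc : DifferentiableWithinAt ℝ (fun a => (MvPowerSeries.constantCoeff (P a))⁻¹) s α :=
    DifferentiableWithinAt.inv (by simpa using (hP 0).differentiableWithinAt) (h0 α hα)
  have hd : ∀ k, DifferentiableWithinAt ℝ (fun a => MvPowerSeries.coeff k (P a)⁻¹) s α := by
    intro k
    induction k using WellFoundedLT.induction with
    | ind k ih =>
      have hk' := fun a => MvPowerSeries.coeff_inv k (P a)
      simp only [hk']
      split_ifs with hk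
      · exact hc
      · refine DifferentiableWithinAt.mul hc.neg ?_
        refine DifferentiableWithinAt.fun_sum fun p _ => ?_
        split_ifs with hp
        · exact (hP _).differentiableWithinAt.mul (ih _ hp)
        · exact differentiableWithinAt_const _
  set φ' : MvPowerSeries (Fin n) ℝ :=
    fun k => derivWithin (fun a => MvPowerSeries.coeff k (P a)⁻¹) s α with hφ'
  have hφ : HD (fun a => (P a)⁻¹) φ' s α := fun k => (hd k).hasDerivWithinAt
  have hm := hP.mul hφ
  have hz : P' * (P α)⁻¹ + P α * φ' = 0 := by
    ext k
    have h1 := hm k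
    have h2 : HasDerivWithinAt (fun a => MvPowerSeries.coeff k (P a * (P a)⁻¹)) 0 s α := by
      refine (hasDerivWithinAt_const α s (MvPowerSeries.coeff k
        (1 : MvPowerSeries (Fin n) ℝ))).congr (fun a ha => ?_) ?_
      · rw [MvPowerSeries.mul_inv_cancel _ (h0 a ha)]
      · rw [MvPowerSeries.mul_inv_cancel _ (h0 α hα)]
    simpa using hs.eq_deriv _ h1 h2
  have hc := MvPowerSeries.mul_inv_cancel _ (h0 α hα)
  have : φ' = -((P α)⁻¹ * ((P α)⁻¹ * P')) := by
    linear_combination (P α)⁻¹ * hz - φ' * hc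
  rwa [← this]

lemma boxSum_monotone {n : ℕ} (G : ℝ → Matrix (Fin n) (Fin n) ℝ)
    (G' : ℝ → Matrix (Fin n) (Fin n) ℝ)
    (hderiv : ∀ i j, ∀ α ∈ Set.Icc (0 : ℝ) 1,
      HasDerivWithinAt (fun a => G a i j) (G' α i j) (Set.Icc (0 : ℝ) 1) α)
    (hd : ∀ i, ∀ α ∈ Set.Icc (0 : ℝ) 1, G' α i i ≤ 0)
    (ho : ∀ i j, i ≠ j → ∀ α ∈ Set.Icc (0 : ℝ) 1, 0 ≤ G' α i j)
    (hG : ∀ α ∈ Set.Icc (0 : ℝ) 1, Good (G α)) (θ : ℝ) (hθ : 0 ≤ θ)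
    (hφ : ∀ α ∈ Set.Icc (0 : ℝ) 1, NN ((Wm θ (G α)).det)⁻¹) (b : Fin n →₀ ℕ) :
    MonotoneOn (fun α => boxSum b ((Wm θ (G α)).det)⁻¹) (Set.Icc (0 : ℝ) 1) := by
  have hcc : ∀ α ∈ Set.Icc (0 : ℝ) 1,
      MvPowerSeries.constantCoeff (Wm θ (G α)).det ≠ 0 := by
    intro α hα
    rw [RingHom.map_det]
    have h : MvPowerSeries.constantCoeff.mapMatrix (Wm θ (G α)) =
        1 + Matrix.diagonal (fun _ => θ) * G α := by
      apply Matrix.ext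
      intro i j
      by_cases hij : i = j
      · subst hij; simp [Wm, dser]
      · simp [Wm, dser, hij]
    rw [h]
    exact (hG α hα).det_ne _ fun _ => hθ
  have key : ∀ α ∈ Set.Icc (0 : ℝ) 1, ∃ D, 0 ≤ D ∧
      HasDerivWithinAt (fun α => boxSum b ((Wm θ (G α)).det)⁻¹) D (Set.Icc (0 : ℝ) 1) α := by
    intro α hα
    set φ := ((Wm θ (G α)).det)⁻¹ with hφd
    set V := (1 - Matrix.diagonal (dser θ) * (Km θ (G α) 1)⁻¹ :
      Matrix (Fin n) (Fin n) (MvPowerSeries (Fin n) ℝ)) with hV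
    have hW : ∀ i j, HD (fun a => Wm θ (G a) i j)
        (dser θ i * MvPowerSeries.C (G' α i j)) (Set.Icc (0 : ℝ) 1) α := by
      intro i j
      have h1 : HD (fun a => MvPowerSeries.C (G a i j) : ℝ → MvPowerSeries (Fin n) ℝ)
          (MvPowerSeries.C (G' α i j)) (Set.Icc (0 : ℝ) 1) α := by
        classical
        intro k
        simp only [MvPowerSeries.coeff_C]
        split_ifs
        · exact hderiv i j α hα
        · exact hasDerivWithinAt_const _ _ _
      have h2 := (HD_const (dser θ i) (Set.Icc (0 : ℝ) 1) α).mul h1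
      intro k
      have h3 := (h2 k).const_add (MvPowerSeries.coeff k
        ((1 : Matrix (Fin n) (Fin n) (MvPowerSeries (Fin n) ℝ)) i j))
      simpa [Wm, Matrix.add_apply, Matrix.diagonal_mul] using h3
    have hinv := HD.inv (uniqueDiffOn_Icc zero_lt_one α hα) hα hcc (HD.det hW)
    have hadj : φ • (Wm θ (G α)).adjugate = V := by
      have h1 := Wm_inv (hG α hα) θ hθ
      have h2 : (Wm θ (G α)).adjugate * (Wm θ (G α) * V) = (Wm θ (G α)).det • V := by
        rw [← mul_assoc, Matrix.adjugate_mul, Matrix.smul_mul, one_mul]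
      rw [h1, mul_one] at h2
      rw [h2, smul_smul, hφd, MvPowerSeries.inv_mul_cancel _ (hcc α hα), one_smul]
    have hD : -(φ * (φ * ∑ i, ∑ j, (Wm θ (G α)).adjugate i j *
        (dser θ j * MvPowerSeries.C (G' α j i)))) =
        ∑ i, ∑ j, MvPowerSeries.C (-(G' α j i)) * (φ * (dser θ j * V i j)) := by
      rw [← hadj]
      simp only [Finset.mul_sum, ← Finset.sum_neg_distrib, Matrix.smul_apply, smul_eq_mul, map_neg]
      refine Finset.sum_congr rfl fun i _ => Finset.sum_congr rfl fun j _ => ?_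
      ring
    rw [hD] at hinv
    refine ⟨_, ?_, HasDerivWithinAt.fun_sum fun k _ => hinv k⟩
    simp only [map_sum, MvPowerSeries.coeff_C_mul]
    rw [Finset.sum_comm]
    refine Finset.sum_nonneg fun i _ => ?_
    rw [Finset.sum_comm]
    refine Finset.sum_nonneg fun j _ => ?_
    rw [← Finset.mul_sum]
    change 0 ≤ -(G' α j i) * boxSum b (φ * (dser θ j * V i j))
    by_cases hij : j = i
    · subst hij
      exact mul_nonneg (by linarith [hd j α hα]) (diag_sign (hG α hα) θ hθ φ (hφ α hα) b j)
    · have h1 := offdiag_sign (hG α hα) θ hθ φ (hφ α hα) b j i hij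
      have h2 := ho j i hij α hα
      nlinarith
  refine monotoneOn_of_deriv_nonneg (convex_Icc 0 1) ?_ ?_ ?_
  · intro α hα
    obtain ⟨D, _, h⟩ := key α hα
    exact h.continuousWithinAt
  · intro α hα
    obtain ⟨D, _, h⟩ := key α (interior_subset hα)
    exact (h.mono interior_subset).differentiableWithinAt
  · intro α hα
    obtain ⟨D, h0, h⟩ := key α (interior_subset hα)
    rw [(h.hasDerivAt (mem_interior_iff_mem_nhds.mp hα)).deriv]
    exact h0

end SlepAux

namespace SlepAux

lemma hasSum_poly_mul {n : ℕ} (p : MvPolynomial (Fin n) ℝ) (F : MvPowerSeries (Fin n) ℝ)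
    (s : Fin n → ℝ) (v : ℝ)
    (h : HasSum (fun k : Fin n →₀ ℕ => MvPowerSeries.coeff k F * ∏ i, s i ^ k i) v) :
    HasSum (fun k : Fin n →₀ ℕ =>
      MvPowerSeries.coeff k ((p : MvPowerSeries (Fin n) ℝ) * F) * ∏ i, s i ^ k i)
      (MvPolynomial.eval s p * v) := by
  induction p using MvPolynomial.induction_on with
  | C a =>
    simp only [MvPolynomial.coe_C, MvPowerSeries.coeff_C_mul, MvPolynomial.eval_C, mul_assoc]
    exact h.mul_left a
  | add p q hp hq =>
    simp only [MvPolynomial.coe_add, add_mul, map_add]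
    exact hp.add hq
  | mul_X p j hp =>
    have e : ((p * MvPolynomial.X j : MvPolynomial (Fin n) ℝ) : MvPowerSeries (Fin n) ℝ) * F =
        MvPowerSeries.X j * ((p : MvPowerSeries (Fin n) ℝ) * F) := by
      rw [MvPolynomial.coe_mul, MvPolynomial.coe_X]; ring
    rw [e]
    have hinj : Function.Injective (fun k : Fin n →₀ ℕ => k + Finsupp.single j 1) :=
      add_left_injective _
    rw [← hinj.hasSum_iff]
    · have h2 : MvPolynomial.eval s (p * MvPolynomial.X j) * v =
          s j * (MvPolynomial.eval s p * v) := by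
        rw [map_mul, MvPolynomial.eval_X]; ring
      rw [h2]
      refine (hp.mul_left (s j)).congr_fun (fun k => ?_)
      have h1 : ∏ i, s i ^ (k + Finsupp.single j 1 : Fin n →₀ ℕ) i = s j * ∏ i, s i ^ k i := by
        simp only [Finsupp.add_apply, pow_add, Finset.prod_mul_distrib]
        rw [mul_comm]
        congr 1
        rw [Finset.prod_eq_single j]
        · simp
        · intro i _ hi
          simp [Finsupp.single_apply, Ne.symm hi]
        · simp
      simp only [Function.comp, coeff_X_mul']
      rw [h1]
      simp
      ring
    · intro k hk
      rw [coeff_X_mul', if_neg, zero_mul]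
      intro hk'
      refine hk ⟨k - Finsupp.single j 1, ?_⟩
      refine tsub_add_cancel_of_le ?_
      simpa using Nat.one_le_iff_ne_zero.mpr hk'.ne'

open Filter Topology in
lemma uni_zero (h : ℕ → ℝ) (hs : ∀ t ∈ Set.Icc (0 : ℝ) 1, HasSum (fun m => h m * t ^ m) 0) :
    ∀ m, h m = 0 := by
  intro M
  induction M using Nat.strong_induction_on with
  | _ M ih =>
    have hsum : Summable (fun m => |h (m + M)|) := by
      have h1 := (hs 1 (by simp)).summable
      simp only [one_pow, mul_one] at h1
      exact ((summable_nat_add_iff M).mpr h1).abs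
    set g : ℝ → ℝ := fun t => ∑' m, h (m + M) * t ^ m with hg
    have hcont : ContinuousOn g (Set.Icc 0 1) := by
      refine continuousOn_tsum (fun m => by fun_prop) hsum fun m t ht => ?_
      rw [norm_mul, Real.norm_eq_abs, norm_pow]
      refine mul_le_of_le_one_right (abs_nonneg _) (pow_le_one₀ (norm_nonneg _) ?_)
      rw [Real.norm_eq_abs, abs_of_nonneg ht.1]; exact ht.2
    have hz : ∀ t ∈ Set.Ioc (0 : ℝ) 1, g t = 0 := by
      intro t ht
      have h1 := (hasSum_nat_add_iff' M).mpr (hs t ⟨ht.1.le, ht.2⟩)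
      rw [Finset.sum_eq_zero (fun m hm => by rw [ih m (Finset.mem_range.mp hm), zero_mul]),
        sub_zero] at h1
      have h2 := h1.mul_right (t ^ M)⁻¹
      rw [zero_mul] at h2
      have h3 : (fun m => h (m + M) * t ^ (m + M) * (t ^ M)⁻¹) = fun m => h (m + M) * t ^ m := by
        ext m
        have : t ^ M ≠ 0 := pow_ne_zero _ ht.1.ne'
        rw [pow_add]; field_simp
      rw [h3] at h2
      exact h2.tsum_eq
    have h0 : g 0 = h M := by
      simp only [hg]
      rw [tsum_eq_single 0]
      · simp
      · intro m hm; simp [hm]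
    have hc0 : Tendsto g (𝓝[Set.Ioc 0 1] 0) (𝓝 (g 0)) :=
      (hcont 0 (by simp)).mono_left (nhdsWithin_mono _ Set.Ioc_subset_Icc_self)
    have hc1 : Tendsto g (𝓝[Set.Ioc 0 1] 0) (𝓝 0) := by
      refine tendsto_const_nhds.congr' ?_
      filter_upwards [self_mem_nhdsWithin] with t ht
      exact (hz t ht).symm
    have : (𝓝[Set.Ioc (0 : ℝ) 1] 0).NeBot := by
      rw [← mem_closure_iff_nhdsWithin_neBot, closure_Ioc (by norm_num)]
      simp
    rw [← h0]
    exact tendsto_nhds_unique hc0 hc1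

lemma multi_zero (n : ℕ) : ∀ (d : (Fin n → ℕ) → ℝ)
    (_ : ∀ s : Fin n → ℝ, (∀ i, s i ∈ Set.Icc (0 : ℝ) 1) →
      HasSum (fun k => d k * ∏ i, s i ^ k i) 0), ∀ k, d k = 0 := by
  induction n with
  | zero =>
    intro d h k
    have h1 := h (fun _ => 0) (fun i => i.elim0)
    simp only [Finset.univ_eq_empty, Finset.prod_empty, mul_one] at h1
    have h2 := hasSum_unique d
    have h3 := h2.unique h1
    rw [← h3]
    congr 1
    exact Subsingleton.elim _ _
  | succ n ih =>
    intro d h k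
    have hin : ∀ s : Fin n → ℝ, (∀ i, s i ∈ Set.Icc (0 : ℝ) 1) → ∀ m,
        HasSum (fun k : Fin n → ℕ => d (Fin.cons m k) * ∏ i, s i ^ k i) 0 := by
      intro s hs
      have h1 : ∀ t ∈ Set.Icc (0 : ℝ) 1, HasSum (fun p : ℕ × (Fin n → ℕ) =>
          (d (Fin.cons p.1 p.2) * ∏ i, s i ^ p.2 i) * t ^ p.1) 0 := by
        intro t ht
        have h2 := h (Fin.cons t s) (fun i => by
          refine Fin.cases ?_ (fun j => ?_) i
          · simpa using ht
          · simpa using hs j)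
        rw [← (Fin.consEquiv (fun _ : Fin (n + 1) => ℕ)).hasSum_iff] at h2
        refine h2.congr_fun ?_
        intro p
        simp [Fin.consEquiv, Fin.prod_univ_succ]
        ring
      have hsm : ∀ m, Summable (fun k : Fin n → ℕ => d (Fin.cons m k) * ∏ i, s i ^ k i) := by
        intro m
        have := (h1 1 (by simp)).summable.prod_factor m
        simpa using this
      have h3 := uni_zero (fun m => ∑' k : Fin n → ℕ, d (Fin.cons m k) * ∏ i, s i ^ k i)
        (fun t ht => by
          have := (h1 t ht).prod_fiberwise (fun m => ((hsm m).hasSum.mul_right (t ^ m)))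
          exact this)
      intro m
      have := (hsm m).hasSum
      rwa [h3 m] at this
    have h4 := ih (fun k' => d (Fin.cons (k 0) k')) (fun s hs => hin s hs (k 0)) (Fin.tail k)
    simpa using h4

lemma hasSum_pi_prod (n : ℕ) : ∀ (f : Fin n → ℕ → ℝ) (a : Fin n → ℝ)
    (_ : ∀ i m, 0 ≤ f i m) (_ : ∀ i, HasSum (f i) (a i)),
    HasSum (fun k : Fin n → ℕ => ∏ i, f i (k i)) (∏ i, a i) := by
  induction n with
  | zero =>
    intro f a _ _
    simpa using hasSum_unique (fun k : Fin 0 → ℕ => (1 : ℝ))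
  | succ n ih =>
    intro f a hf ha
    rw [← (Fin.consEquiv (fun _ : Fin (n + 1) => ℕ)).hasSum_iff, Fin.prod_univ_succ]
    have h1 := ih (fun i => f i.succ) (fun i => a i.succ) (fun i m => hf _ _) (fun i => ha _)
    have h3 : Summable (fun x : ℕ × (Fin n → ℕ) => f 0 x.1 * ∏ i : Fin n, f i.succ (x.2 i)) :=
      Summable.mul_of_nonneg (f := f 0) (g := fun k : Fin n → ℕ => ∏ i : Fin n, f i.succ (k i))
        (ha 0).summable h1.summable (fun m => hf 0 m)
        (fun k => Finset.prod_nonneg fun i _ => hf _ _)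
    have h2 := HasSum.mul (f := f 0) (g := fun k : Fin n → ℕ => ∏ i : Fin n, f i.succ (k i))
      (ha 0) h1 h3
    refine h2.congr_fun (fun p => ?_)
    simp [Fin.consEquiv, Fin.prod_univ_succ]

/-- Poisson distribution function. -/
noncomputable def pois (N : ℕ) (y : ℝ) : ℝ :=
  ∑ m ∈ Finset.range (N + 1), Real.exp (-y) * (y ^ m / (m.factorial : ℝ))

/-- Joint Poisson weights. -/
noncomputable def pw {n : ℕ} (y : Fin n → ℝ) (k : Fin n →₀ ℕ) : ℝ :=
  ∏ i, (Real.exp (-(y i)) * (y i ^ k i / ((k i).factorial : ℝ)))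

lemma pw_nonneg {n : ℕ} (y : Fin n → ℝ) (hy : ∀ i, 0 ≤ y i) (k : Fin n →₀ ℕ) : 0 ≤ pw y k :=
  Finset.prod_nonneg fun i _ => mul_nonneg (Real.exp_pos _).le
    (div_nonneg (pow_nonneg (hy i) _) (Nat.cast_nonneg _))

lemma pw_hasSum {n : ℕ} (y : Fin n → ℝ) (hy : ∀ i, 0 ≤ y i) (s : Fin n → ℝ)
    (hs : ∀ i, 0 ≤ s i) :
    HasSum (fun k : Fin n →₀ ℕ => pw y k * ∏ i, s i ^ k i)
      (Real.exp (-(∑ i, (1 - s i) * y i))) := by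
  have h := hasSum_pi_prod n (fun i m => Real.exp (-(y i)) * ((s i * y i) ^ m / (m.factorial : ℝ)))
    (fun i => Real.exp (-(y i)) * Real.exp (s i * y i))
    (fun i m => mul_nonneg (Real.exp_pos _).le
      (div_nonneg (pow_nonneg (mul_nonneg (hs i) (hy i)) _) (Nat.cast_nonneg _)))
    (fun i => by
      refine HasSum.mul_left _ ?_
      rw [Real.exp_eq_exp_ℝ]
      exact NormedSpace.expSeries_div_hasSum_exp (s i * y i))
  have e1 : ∏ i, Real.exp (-(y i)) * Real.exp (s i * y i) =
      Real.exp (-(∑ i, (1 - s i) * y i)) := by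
    simp_rw [← Real.exp_add]
    rw [← Real.exp_sum, ← Finset.sum_neg_distrib]
    congr 1
    exact Finset.sum_congr rfl fun i _ => by ring
  rw [e1, ← Finsupp.equivFunOnFinite.hasSum_iff] at h
  refine h.congr_fun ?_
  intro k
  simp only [Function.comp, pw, Finsupp.equivFunOnFinite_apply, ← Finset.prod_mul_distrib]
  exact Finset.prod_congr rfl fun i _ => by rw [mul_pow]; ring

lemma sum_pw {n : ℕ} (y : Fin n → ℝ) (b : Fin n →₀ ℕ) :
    ∑ k ∈ Finset.Iic b, pw y k = ∏ i, pois (b i) (y i) := by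
  classical
  unfold pois
  rw [Finset.prod_univ_sum]
  refine Finset.sum_nbij' (fun k => ⇑k) (fun f => Finsupp.equivFunOnFinite.symm f) ?_ ?_ ?_ ?_ ?_
  · intro k hk
    simp only [Finset.mem_Iic, Fintype.mem_piFinset, Finset.mem_range] at hk ⊢
    intro i
    have := hk i
    omega
  · intro f hf
    simp only [Finset.mem_Iic, Fintype.mem_piFinset, Finset.mem_range] at hf ⊢
    intro i
    have := hf i
    simp
    omega
  · intro k _
    ext i; simp
  · intro f _
    ext i; simp
  · intro k _
    rfl

end SlepAux

namespace SlepAux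

lemma pw_measurable {n : ℕ} (k : Fin n →₀ ℕ) : Measurable (fun y : Fin n → ℝ => pw y k) := by
  unfold pw
  fun_prop

lemma pw_sum_le_one {n : ℕ} (y : Fin n → ℝ) (hy : ∀ i, 0 ≤ y i) (S : Finset (Fin n →₀ ℕ)) :
    ∑ k ∈ S, pw y k ≤ 1 := by
  have h := pw_hasSum y hy 1 (fun _ => zero_le_one)
  simp only [Pi.one_apply, one_pow, Finset.prod_const_one, mul_one, sub_self, zero_mul,
    Finset.sum_const_zero, neg_zero, Real.exp_zero] at h
  exact sum_le_hasSum S (fun k _ => pw_nonneg y hy k) h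

lemma pw_le_one {n : ℕ} (y : Fin n → ℝ) (hy : ∀ i, 0 ≤ y i) (k : Fin n →₀ ℕ) : pw y k ≤ 1 := by
  simpa using pw_sum_le_one y hy {k}

lemma pw_integrable {n : ℕ} {Ω : Type} [MeasurableSpace Ω] (μ : Measure Ω)
    [IsProbabilityMeasure μ] (Y : Ω → Fin n → ℝ) (hm : Measurable Y) (hY : ∀ ω i, 0 ≤ Y ω i)
    (k : Fin n →₀ ℕ) : Integrable (fun ω => pw (Y ω) k) μ := by
  refine Integrable.of_bound ((pw_measurable k).comp hm).aestronglyMeasurable 1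
    (Filter.Eventually.of_forall fun ω => ?_)
  rw [Real.norm_of_nonneg (pw_nonneg _ (hY ω) k)]
  exact pw_le_one _ (hY ω) k

lemma gen_hasSum {n : ℕ} {Ω : Type} [MeasurableSpace Ω] (μ : Measure Ω)
    [IsProbabilityMeasure μ] (Y : Ω → Fin n → ℝ) (hm : Measurable Y) (hY : ∀ ω i, 0 ≤ Y ω i)
    (s : Fin n → ℝ) (hs : ∀ i, s i ∈ Set.Icc (0 : ℝ) 1) :
    HasSum (fun k : Fin n →₀ ℕ => (∫ ω, pw (Y ω) k ∂μ) * ∏ i, s i ^ k i)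
      (∫ ω, Real.exp (-(∑ i, (1 - s i) * Y ω i)) ∂μ) := by
  have hsn : ∀ k : Fin n →₀ ℕ, 0 ≤ ∏ i, s i ^ k i := fun k =>
    Finset.prod_nonneg fun i _ => pow_nonneg (hs i).1 _
  have hs1 : ∀ k : Fin n →₀ ℕ, ∏ i, s i ^ k i ≤ 1 := fun k =>
    Finset.prod_le_one (fun i _ => pow_nonneg (hs i).1 _)
      (fun i _ => pow_le_one₀ (hs i).1 (hs i).2)
  have hItg : ∀ k : Fin n →₀ ℕ, Integrable (fun ω => pw (Y ω) k * ∏ i, s i ^ k i) μ :=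
    fun k => (pw_integrable μ Y hm hY k).mul_const _
  have hsum : Summable (fun k : Fin n →₀ ℕ => ∫ ω, ‖pw (Y ω) k * ∏ i, s i ^ k i‖ ∂μ) := by
    refine summable_of_sum_le (c := 1) (fun k => integral_nonneg fun ω => norm_nonneg _) ?_
    intro S
    rw [← integral_finset_sum S (fun k _ => (hItg k).norm)]
    have : ∫ ω, ∑ k ∈ S, ‖pw (Y ω) k * ∏ i, s i ^ k i‖ ∂μ ≤ ∫ _ω, (1 : ℝ) ∂μ := by
      refine integral_mono (integrable_finset_sum S fun k _ => (hItg k).norm)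
        (integrable_const _) fun ω => ?_
      refine le_trans (Finset.sum_le_sum fun k _ => ?_) (pw_sum_le_one (Y ω) (hY ω) S)
      rw [Real.norm_of_nonneg (mul_nonneg (pw_nonneg _ (hY ω) k) (hsn k))]
      exact mul_le_of_le_one_right (pw_nonneg _ (hY ω) k) (hs1 k)
    simpa using this
  have h := hasSum_integral_of_summable_integral_norm hItg hsum
  have e : (fun ω => ∑' k : Fin n →₀ ℕ, pw (Y ω) k * ∏ i, s i ^ k i) =
      fun ω => Real.exp (-(∑ i, (1 - s i) * Y ω i)) := by
    funext ω
    exact (pw_hasSum (Y ω) (hY ω) s (fun i => (hs i).1)).tsum_eq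
  rw [e] at h
  refine h.congr_fun fun k => ?_
  rw [integral_mul_const]

/-- Polynomial version of `Wm`. -/
noncomputable def Wp {n : ℕ} (θ : ℝ) (G : Matrix (Fin n) (Fin n) ℝ) :
    Matrix (Fin n) (Fin n) (MvPolynomial (Fin n) ℝ) :=
  1 + Matrix.diagonal (fun i => MvPolynomial.C θ * (1 - MvPolynomial.X i)) *
    G.map MvPolynomial.C

lemma Wp_coe {n : ℕ} (θ : ℝ) (G : Matrix (Fin n) (Fin n) ℝ) :
    (((Wp θ G).det : MvPolynomial (Fin n) ℝ) : MvPowerSeries (Fin n) ℝ) = (Wm θ G).det := by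
  have h : MvPolynomial.coeToMvPowerSeries.ringHom.mapMatrix (Wp θ G) = Wm θ G := by
    apply Matrix.ext
    intro i j
    have hx : MvPolynomial.coeToMvPowerSeries.ringHom
        (1 - MvPolynomial.X i : MvPolynomial (Fin n) ℝ) = 1 - MvPowerSeries.X i := by
      rw [map_sub, map_one]
      congr 1
      exact MvPolynomial.coe_X i
    have hC : ∀ a : ℝ, MvPolynomial.coeToMvPowerSeries.ringHom
        (MvPolynomial.C a : MvPolynomial (Fin n) ℝ) = MvPowerSeries.C a := fun a =>
      MvPolynomial.coe_C a
    have h1 : Wp θ G i j = (1 : Matrix (Fin n) (Fin n) (MvPolynomial (Fin n) ℝ)) i j +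
        MvPolynomial.C θ * (1 - MvPolynomial.X i) * MvPolynomial.C (G i j) := by
      simp [Wp]
    have h2 : Wm θ G i j = (1 : Matrix (Fin n) (Fin n) (MvPowerSeries (Fin n) ℝ)) i j +
        MvPowerSeries.C θ * (1 - MvPowerSeries.X i) * MvPowerSeries.C (G i j) := by
      simp [Wm, dser]
    rw [RingHom.mapMatrix_apply, Matrix.map_apply, h1, h2, map_add, map_mul, map_mul, hx, hC, hC]
    congr 1
    by_cases hij : i = j
    · subst hij; simp
    · simp [hij]
  rw [← h, ← RingHom.map_det]
  rfl

lemma Wp_eval {n : ℕ} (θ : ℝ) (G : Matrix (Fin n) (Fin n) ℝ) (s : Fin n → ℝ) :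
    MvPolynomial.eval s (Wp θ G).det =
      (1 + Matrix.diagonal (fun i => (1 - s i) * θ) * G).det := by
  rw [RingHom.map_det]
  congr 1
  apply Matrix.ext
  intro i j
  by_cases hij : i = j
  · subst hij; simp [Wp, mul_comm]
  · simp [Wp, hij, mul_comm]

lemma perm_coeff {n : ℕ} {G : Matrix (Fin n) (Fin n) ℝ} (hG : Good G) (θ : ℝ) (hθ : 0 ≤ θ)
    {Ω : Type} [MeasurableSpace Ω] (μ : Measure Ω) [IsProbabilityMeasure μ]
    (l : Ω → Fin n → ℝ) (hm : Measurable l) (hl : ∀ ω i, 0 ≤ l ω i)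
    (hperm : ∀ lam : Fin n → ℝ, (∀ i, 0 ≤ lam i) →
      ∫ ω, Real.exp (-(∑ i, lam i * l ω i)) ∂μ = ((1 + Matrix.diagonal lam * G).det)⁻¹) :
    NN ((Wm θ G).det)⁻¹ ∧ ∀ b : Fin n →₀ ℕ, boxSum b ((Wm θ G).det)⁻¹ =
      ∫ ω, ∏ i, pois (b i) (θ * l ω i) ∂μ := by
  set Y : Ω → Fin n → ℝ := fun ω i => θ * l ω i with hYd
  have hYm : Measurable Y := by
    refine measurable_pi_lambda _ fun i => ?_
    exact ((measurable_pi_apply i).comp hm).const_mul θ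
  have hY : ∀ ω i, 0 ≤ Y ω i := fun ω i => mul_nonneg hθ (hl ω i)
  let c : MvPowerSeries (Fin n) ℝ := fun k => ∫ ω, pw (Y ω) k ∂μ
  have hc : ∀ k, MvPowerSeries.coeff k c = ∫ ω, pw (Y ω) k ∂μ := fun k => rfl
  have hcc : MvPowerSeries.constantCoeff (Wm θ G).det ≠ 0 := by
    rw [RingHom.map_det]
    have h : MvPowerSeries.constantCoeff.mapMatrix (Wm θ G) =
        1 + Matrix.diagonal (fun _ => θ) * G := by
      apply Matrix.ext
      intro i j
      by_cases hij : i = j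
      · subst hij; simp [Wm, dser]
      · simp [Wm, dser, hij]
    rw [h]
    exact hG.det_ne _ fun _ => hθ
  have hmul : (Wm θ G).det * c = 1 := by
    have hz := multi_zero n (fun k => MvPowerSeries.coeff (Finsupp.equivFunOnFinite.symm k)
      ((Wm θ G).det * c - 1)) (fun s hs => by
        have h1 := gen_hasSum μ Y hYm hY s hs
        have hnn : ∀ i, 0 ≤ (1 - s i) * θ := fun i => mul_nonneg (by linarith [(hs i).2]) hθ
        have h2 := hasSum_poly_mul (Wp θ G).det c s _ h1
        have h3 : ∫ ω, Real.exp (-(∑ i, (1 - s i) * Y ω i)) ∂μ =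
            ((1 + Matrix.diagonal (fun i => (1 - s i) * θ) * G).det)⁻¹ := by
          rw [← hperm _ hnn]
          simp only [hYd, mul_assoc]
        rw [h3, Wp_eval, mul_inv_cancel₀ (hG.det_ne _ hnn), Wp_coe] at h2
        have h4 : HasSum (fun k : Fin n →₀ ℕ =>
            MvPowerSeries.coeff k (1 : MvPowerSeries (Fin n) ℝ) * ∏ i, s i ^ k i) 1 := by
          have h5 := hasSum_ite_eq (0 : Fin n →₀ ℕ) (1 : ℝ)
          refine h5.congr_fun fun k => ?_
          classical
          rw [MvPowerSeries.coeff_one]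
          by_cases hk : k = 0
          · subst hk; simp
          · simp [hk]
        have h6 := h2.sub h4
        rw [sub_self, ← Finsupp.equivFunOnFinite.symm.hasSum_iff] at h6
        refine h6.congr_fun fun k => ?_
        simp only [Function.comp, map_sub, sub_mul, Finsupp.equivFunOnFinite_symm_apply_apply])
    rw [← sub_eq_zero]
    ext k
    have := hz (Finsupp.equivFunOnFinite k)
    simpa using this
  have hinv : ((Wm θ G).det)⁻¹ = c := by
    symm
    rw [MvPowerSeries.eq_inv_iff_mul_eq_one hcc, mul_comm]
    exact hmul
  rw [hinv]
  refine ⟨fun k => ?_, fun b => ?_⟩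
  · rw [hc]
    exact integral_nonneg fun ω => pw_nonneg _ (hY ω) k
  · unfold boxSum
    simp only [hc]
    rw [← integral_finset_sum _ (fun k _ => pw_integrable μ Y hYm hY k)]
    simp only [sum_pw, hYd]

end SlepAux
namespace SlepAux

lemma pois_nonneg (N : ℕ) {y : ℝ} (hy : 0 ≤ y) : 0 ≤ pois N y :=
  Finset.sum_nonneg fun m _ => mul_nonneg (Real.exp_pos _).le
    (div_nonneg (pow_nonneg hy _) (Nat.cast_nonneg _))

lemma pois_eq (N : ℕ) (y : ℝ) : pois N y =
    Real.exp (-y) * ∑ m ∈ Finset.range (N + 1), y ^ m / (m.factorial : ℝ) := by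
  rw [Finset.mul_sum]; rfl

lemma pois_le_one (N : ℕ) {y : ℝ} (hy : 0 ≤ y) : pois N y ≤ 1 := by
  rw [pois_eq]
  calc _ ≤ Real.exp (-y) * Real.exp y :=
        mul_le_mul_of_nonneg_left (Real.sum_le_exp_of_nonneg hy _) (Real.exp_pos _).le
    _ = 1 := by rw [← Real.exp_add]; simp

lemma exp_pow_aux (N : ℕ) (u : ℝ) :
    Real.exp (-(((N : ℝ) + 1) * u)) * (u ^ (N + 1) * Real.exp ((N : ℝ) + 1)) =
      (u * Real.exp (1 - u)) ^ (N + 1) := by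
  rw [mul_pow, ← Real.exp_nat_mul, mul_left_comm, ← Real.exp_add]
  congr 2
  push_cast
  ring

lemma pois_upper (N : ℕ) {u : ℝ} (hu : 1 ≤ u) :
    pois N (((N : ℝ) + 1) * u) ≤ (u * Real.exp (1 - u)) ^ (N + 1) := by
  rw [pois_eq, ← exp_pow_aux]
  refine mul_le_mul_of_nonneg_left ?_ (Real.exp_pos _).le
  have h0 : (0 : ℝ) ≤ (N : ℝ) + 1 := by positivity
  calc _ ≤ ∑ m ∈ Finset.range (N + 1),
        u ^ (N + 1) * (((N : ℝ) + 1) ^ m / (m.factorial : ℝ)) := by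
        refine Finset.sum_le_sum fun m hm => ?_
        rw [mul_pow, mul_comm (((N : ℝ) + 1) ^ m), mul_div_assoc]
        refine mul_le_mul_of_nonneg_right ?_ (by positivity)
        exact pow_le_pow_right₀ hu (Finset.mem_range.mp hm).le
    _ ≤ _ := by
        rw [← Finset.mul_sum]
        exact mul_le_mul_of_nonneg_left (Real.sum_le_exp_of_nonneg h0 _) (by positivity)

lemma pois_lower (N : ℕ) {u : ℝ} (hu0 : 0 ≤ u) (hu : u ≤ 1) :
    1 - (u * Real.exp (1 - u)) ^ (N + 1) ≤ pois N (((N : ℝ) + 1) * u) := by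
  have hexp : ∀ y : ℝ, HasSum (fun m : ℕ => y ^ m / (m.factorial : ℝ)) (Real.exp y) := by
    intro y
    rw [Real.exp_eq_exp_ℝ]
    exact NormedSpace.expSeries_div_hasSum_exp y
  have h0 : (0 : ℝ) ≤ (N : ℝ) + 1 := by positivity
  have h1 := (hasSum_nat_add_iff' (N + 1)).mpr (hexp (((N : ℝ) + 1) * u))
  have h2 := ((hasSum_nat_add_iff' (N + 1)).mpr (hexp ((N : ℝ) + 1))).mul_left (u ^ (N + 1))
  have h3 := hasSum_le (fun m => by
    rw [mul_pow, mul_comm (((N : ℝ) + 1) ^ (m + (N + 1))), mul_div_assoc]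
    refine mul_le_mul_of_nonneg_right ?_ (by positivity)
    exact pow_le_pow_of_le_one hu0 hu (by omega)) h1 h2
  have h4 : u ^ (N + 1) * (Real.exp ((N : ℝ) + 1) - ∑ m ∈ Finset.range (N + 1),
      ((N : ℝ) + 1) ^ m / (m.factorial : ℝ)) ≤ u ^ (N + 1) * Real.exp ((N : ℝ) + 1) := by
    refine mul_le_mul_of_nonneg_left ?_ (by positivity)
    have : 0 ≤ ∑ m ∈ Finset.range (N + 1), ((N : ℝ) + 1) ^ m / (m.factorial : ℝ) :=
      Finset.sum_nonneg fun m _ => by positivity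
    linarith
  have h5 := mul_le_mul_of_nonneg_left (h3.trans h4)
    (Real.exp_pos (-(((N : ℝ) + 1) * u))).le
  rw [exp_pow_aux, mul_sub, ← Real.exp_add, neg_add_cancel, Real.exp_zero, ← pois_eq] at h5
  linarith

lemma chern_lt {u : ℝ} (hu : u ≠ 1) : u * Real.exp (1 - u) < 1 := by
  have h := Real.add_one_lt_exp (sub_ne_zero.mpr hu)
  have h1 : u < Real.exp (u - 1) := by linarith
  calc u * Real.exp (1 - u) < Real.exp (u - 1) * Real.exp (1 - u) :=
        mul_lt_mul_of_pos_right h1 (Real.exp_pos _)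
    _ = 1 := by rw [← Real.exp_add]; simp

open Filter Topology in
lemma chern_tendsto {u : ℝ} (hu0 : 0 ≤ u) (hu : u ≠ 1) :
    Tendsto (fun N : ℕ => (u * Real.exp (1 - u)) ^ (N + 1)) atTop (𝓝 0) :=
  (tendsto_pow_atTop_nhds_zero_of_lt_one (mul_nonneg hu0 (Real.exp_pos _).le)
    (chern_lt hu)).comp (tendsto_add_atTop_nat 1)

open Filter Topology in
lemma pois_tendsto_one {u : ℝ} (hu0 : 0 ≤ u) (hu : u < 1) :
    Tendsto (fun N : ℕ => pois N (((N : ℝ) + 1) * u)) atTop (𝓝 1) := by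
  have h := (chern_tendsto hu0 hu.ne).const_sub 1
  rw [sub_zero] at h
  exact tendsto_of_tendsto_of_tendsto_of_le_of_le h tendsto_const_nhds
    (fun N => pois_lower N hu0 hu.le) (fun N => pois_le_one N (by positivity))

open Filter Topology in
lemma pois_tendsto_zero {u : ℝ} (hu : 1 < u) :
    Tendsto (fun N : ℕ => pois N (((N : ℝ) + 1) * u)) atTop (𝓝 0) :=
  tendsto_of_tendsto_of_tendsto_of_le_of_le tendsto_const_nhds
    (chern_tendsto (by linarith) hu.ne')
    (fun N => pois_nonneg N (by positivity)) (fun N => pois_upper N hu.le)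

end SlepAux
namespace SlepAux

lemma pois_measurable (N : ℕ) : Measurable (pois N) := by
  unfold pois
  fun_prop

open Filter Topology in
lemma box_le {n : ℕ} {Ω : Type} [MeasurableSpace Ω] (μ : Measure Ω) [IsProbabilityMeasure μ]
    (l0 l1 : Ω → Fin n → ℝ) (hm0 : Measurable l0) (hm1 : Measurable l1)
    (h0 : ∀ ω i, 0 ≤ l0 ω i) (h1 : ∀ ω i, 0 ≤ l1 ω i) (y : ℝ) (hy : 0 < y)
    (h : ∀ N : ℕ, ∫ ω, ∏ i, pois N (((N : ℝ) + 1) / y * l0 ω i) ∂μ ≤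
      ∫ ω, ∏ i, pois N (((N : ℝ) + 1) / y * l1 ω i) ∂μ) :
    μ {ω | ∀ i, l0 ω i < y} ≤ μ {ω | ∀ i, l1 ω i ≤ y} := by
  set f0 : ℕ → Ω → ℝ := fun N ω => ∏ i, pois N (((N : ℝ) + 1) / y * l0 ω i) with hf0
  set f1 : ℕ → Ω → ℝ := fun N ω => ∏ i, pois N (((N : ℝ) + 1) / y * l1 ω i) with hf1
  have hr : ∀ (N : ℕ) (t : ℝ), ((N : ℝ) + 1) / y * t = ((N : ℝ) + 1) * (t / y) := by
    intro N t; ring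
  have hgen : ∀ l : Ω → Fin n → ℝ, Measurable l → (∀ ω i, 0 ≤ l ω i) → ∀ N : ℕ,
      Measurable (fun ω => ∏ i, pois N (((N : ℝ) + 1) / y * l ω i)) ∧
      (∀ ω, 0 ≤ ∏ i, pois N (((N : ℝ) + 1) / y * l ω i)) ∧
      (∀ ω, ∏ i, pois N (((N : ℝ) + 1) / y * l ω i) ≤ 1) := by
    intro l hm hl N
    have hp : ∀ ω i, 0 ≤ ((N : ℝ) + 1) / y * l ω i := fun ω i =>
      mul_nonneg (by positivity) (hl ω i)
    refine ⟨?_, fun ω => Finset.prod_nonneg fun i _ => pois_nonneg N (hp ω i),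
      fun ω => Finset.prod_le_one (fun i _ => pois_nonneg N (hp ω i))
        (fun i _ => pois_le_one N (hp ω i))⟩
    refine Finset.measurable_fun_prod _ fun i _ => (pois_measurable N).comp ?_
    exact ((measurable_pi_apply i).comp hm).const_mul _
  set S0 : Set Ω := {ω | ∀ i, l0 ω i < y} with hS0
  set S1 : Set Ω := {ω | ∀ i, l1 ω i ≤ y} with hS1
  have mS0 : MeasurableSet S0 := by
    have : S0 = ⋂ i, {ω | l0 ω i < y} := by ext ω; simp [hS0]
    rw [this]
    exact MeasurableSet.iInter fun i =>
      measurableSet_lt ((measurable_pi_apply i).comp hm0) measurable_const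
  have mS1 : MeasurableSet S1 := by
    have : S1 = ⋂ i, {ω | l1 ω i ≤ y} := by ext ω; simp [hS1]
    rw [this]
    exact MeasurableSet.iInter fun i =>
      measurableSet_le ((measurable_pi_apply i).comp hm1) measurable_const
  have g0 := hgen l0 hm0 h0
  have g1 := hgen l1 hm1 h1
  have i0 : ∀ N, Integrable (f0 N) μ := fun N =>
    Integrable.of_bound (g0 N).1.aestronglyMeasurable 1 (Eventually.of_forall fun ω => by
      rw [Real.norm_of_nonneg ((g0 N).2.1 ω)]; exact (g0 N).2.2 ω)
  have i1 : ∀ N, Integrable (f1 N) μ := fun N =>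
    Integrable.of_bound (g1 N).1.aestronglyMeasurable 1 (Eventually.of_forall fun ω => by
      rw [Real.norm_of_nonneg ((g1 N).2.1 ω)]; exact (g1 N).2.2 ω)
  have t0 : Tendsto (fun N => ∫ ω, S0.indicator (f0 N) ω ∂μ) atTop
      (𝓝 (∫ ω, S0.indicator (fun _ => (1 : ℝ)) ω ∂μ)) := by
    refine tendsto_integral_of_dominated_convergence (fun _ => (1 : ℝ))
      (fun N => ((i0 N).indicator mS0).aestronglyMeasurable) (integrable_const _)
      (fun N => Eventually.of_forall fun ω => ?_) (Eventually.of_forall fun ω => ?_)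
    · refine (norm_indicator_le_norm_self _ _).trans ?_
      rw [Real.norm_of_nonneg ((g0 N).2.1 ω)]; exact (g0 N).2.2 ω
    · by_cases hω : ω ∈ S0
      · simp only [Set.indicator_of_mem hω, hf0, hr]
        have : Tendsto (fun N : ℕ => ∏ i : Fin n, pois N (((N : ℝ) + 1) * (l0 ω i / y))) atTop
            (𝓝 (∏ _i : Fin n, (1 : ℝ))) :=
          tendsto_finset_prod _ fun i _ => pois_tendsto_one (div_nonneg (h0 ω i) hy.le)
            ((div_lt_one hy).mpr (hω i))
        simpa using this
      · simp only [Set.indicator_of_notMem hω]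
        exact tendsto_const_nhds
  have t1 : Tendsto (fun N => ∫ ω, S1ᶜ.indicator (f1 N) ω ∂μ) atTop (𝓝 (∫ _ω, (0 : ℝ) ∂μ)) := by
    refine tendsto_integral_of_dominated_convergence (fun _ => (1 : ℝ))
      (fun N => ((i1 N).indicator mS1.compl).aestronglyMeasurable) (integrable_const _)
      (fun N => Eventually.of_forall fun ω => ?_) (Eventually.of_forall fun ω => ?_)
    · refine (norm_indicator_le_norm_self _ _).trans ?_
      rw [Real.norm_of_nonneg ((g1 N).2.1 ω)]; exact (g1 N).2.2 ω
    · by_cases hω : ω ∈ S1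
      · have : ω ∉ S1ᶜ := fun h => h hω
        simp only [Set.indicator_of_notMem this]
        exact tendsto_const_nhds
      · have hω' : ω ∈ S1ᶜ := hω
        simp only [Set.indicator_of_mem hω', hf1, hr]
        have : ∃ i, y < l1 ω i := by
          by_contra hcon
          push Not at hcon
          exact hω hcon
        obtain ⟨i, hi⟩ := this
        have hp : ∀ (N : ℕ) j, 0 ≤ ((N : ℝ) + 1) * (l1 ω j / y) := fun N j =>
          mul_nonneg (by positivity) (div_nonneg (h1 ω j) hy.le)
        refine tendsto_of_tendsto_of_tendsto_of_le_of_le tendsto_const_nhds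
          (pois_tendsto_zero ((one_lt_div hy).mpr hi))
          (fun N => Finset.prod_nonneg fun j _ => pois_nonneg N (hp N j)) (fun N => ?_)
        dsimp only
        rw [← Finset.mul_prod_erase _ _ (Finset.mem_univ i)]
        exact mul_le_of_le_one_right (pois_nonneg N (hp N i))
          (Finset.prod_le_one (fun j _ => pois_nonneg N (hp N j))
            (fun j _ => pois_le_one N (hp N j)))
  have ind : ∀ S : Set Ω, MeasurableSet S →
      ∫ ω, S.indicator (fun _ => (1 : ℝ)) ω ∂μ = μ.real S := by
    intro S hS
    rw [integral_indicator hS]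
    simp
  have key : ∀ N, ∫ ω, S0.indicator (f0 N) ω ∂μ ≤
      ∫ ω, S1ᶜ.indicator (f1 N) ω ∂μ + μ.real S1 := by
    intro N
    calc ∫ ω, S0.indicator (f0 N) ω ∂μ ≤ ∫ ω, f0 N ω ∂μ := by
          refine integral_mono ((i0 N).indicator mS0) (i0 N) fun ω => ?_
          exact Set.indicator_le_self' (fun ω _ => (g0 N).2.1 ω) ω
      _ ≤ ∫ ω, f1 N ω ∂μ := h N
      _ ≤ ∫ ω, (S1ᶜ.indicator (f1 N) ω + S1.indicator (fun _ => (1 : ℝ)) ω) ∂μ := by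
          refine integral_mono (i1 N) (((i1 N).indicator mS1.compl).add
            ((integrable_const (1 : ℝ)).indicator mS1)) fun ω => ?_
          dsimp only
          by_cases hω : ω ∈ S1
          · have h2 : ω ∉ S1ᶜ := fun h => h hω
            rw [Set.indicator_of_notMem h2, Set.indicator_of_mem hω, zero_add]
            exact (g1 N).2.2 ω
          · have hω' : ω ∈ S1ᶜ := hω
            rw [Set.indicator_of_mem hω', Set.indicator_of_notMem hω, add_zero]
      _ = _ := by
          rw [integral_add ((i1 N).indicator mS1.compl)
            ((integrable_const (1 : ℝ)).indicator mS1), ind S1 mS1]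
  have hlim := le_of_tendsto_of_tendsto' t0 (t1.add_const (μ.real S1)) key
  rw [ind S0 mS0] at hlim
  simp only [integral_zero, zero_add] at hlim
  exact (ENNReal.toReal_le_toReal (measure_ne_top _ _) (measure_ne_top _ _)).mp hlim

open Filter Topology in
lemma box_lt {n : ℕ} {Ω : Type} [MeasurableSpace Ω] (μ : Measure Ω) [IsProbabilityMeasure μ]
    (l0 l1 : Ω → Fin n → ℝ)
    (h : ∀ y : ℝ, 0 < y → μ {ω | ∀ i, l0 ω i < y} ≤ μ {ω | ∀ i, l1 ω i ≤ y})
    (x : ℝ) (hx : 0 < x) :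
    μ {ω | ∀ i, l0 ω i < x} ≤ μ {ω | ∀ i, l1 ω i < x} := by
  obtain ⟨u, hu, hux, hut⟩ := exists_seq_strictMono_tendsto' hx
  have e : {ω | ∀ i, l0 ω i < x} = ⋃ m, {ω | ∀ i, l0 ω i < u m} := by
    ext ω
    simp only [Set.mem_ofPred_eq, Set.mem_iUnion]
    constructor
    · intro hω
      have : ∀ᶠ m in atTop, ∀ i, l0 ω i < u m :=
        eventually_all.mpr fun i => hut.eventually (lt_mem_nhds (hω i))
      exact this.exists
    · rintro ⟨m, hm⟩ i
      exact (hm i).trans (hux m).2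
  have hmono : Monotone fun m => {ω | ∀ i, l0 ω i < u m} := by
    intro a b hab ω hω i
    exact (hω i).trans_le (hu.monotone hab)
  rw [e, hmono.measure_iUnion]
  refine iSup_le fun m => (h (u m) (hux m).1).trans (measure_mono ?_)
  intro ω hω i
  exact (hω i).trans_lt (hux m).2

lemma sign_nonneg (g g' : ℝ → ℝ)
    (hd : ∀ α ∈ Set.Icc (0 : ℝ) 1, HasDerivWithinAt g (g' α) (Set.Icc (0 : ℝ) 1) α)
    (hs : (∀ α ∈ Set.Icc (0 : ℝ) 1, 0 ≤ g' α) ∨ (∀ α ∈ Set.Icc (0 : ℝ) 1, g' α ≤ 0))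
    (h : g 0 ≤ g 1) : ∀ α ∈ Set.Icc (0 : ℝ) 1, 0 ≤ g' α := by
  rcases hs with hs | hs
  · exact hs
  have hanti : AntitoneOn g (Set.Icc 0 1) := by
    refine antitoneOn_of_deriv_nonpos (convex_Icc 0 1)
      (fun α hα => (hd α hα).continuousWithinAt) ?_ ?_
    · intro α hα
      have hα' := interior_subset hα
      exact ((hd α hα').mono interior_subset).differentiableWithinAt
    · intro α hα
      have hα' := interior_subset hα
      rw [interior_Icc] at hα
      rw [((hd α hα').hasDerivAt (Icc_mem_nhds hα.1 hα.2)).deriv]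
      exact hs α hα'
  have hconst : ∀ α ∈ Set.Icc (0 : ℝ) 1, g α = g 0 := by
    intro α hα
    have h1 := hanti (by simp : (0 : ℝ) ∈ Set.Icc (0 : ℝ) 1) hα hα.1
    have h2 := hanti hα (by simp : (1 : ℝ) ∈ Set.Icc (0 : ℝ) 1) hα.2
    linarith
  intro α hα
  have h1 : HasDerivWithinAt g 0 (Set.Icc (0 : ℝ) 1) α :=
    (hasDerivWithinAt_const α _ (g 0)).congr hconst (hconst α hα)
  exact ((uniqueDiffOn_Icc zero_lt_one α hα).eq_deriv _ h1 (hd α hα)).le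

lemma sign_nonpos (g g' : ℝ → ℝ)
    (hd : ∀ α ∈ Set.Icc (0 : ℝ) 1, HasDerivWithinAt g (g' α) (Set.Icc (0 : ℝ) 1) α)
    (hs : (∀ α ∈ Set.Icc (0 : ℝ) 1, 0 ≤ g' α) ∨ (∀ α ∈ Set.Icc (0 : ℝ) 1, g' α ≤ 0))
    (h : g 1 ≤ g 0) : ∀ α ∈ Set.Icc (0 : ℝ) 1, g' α ≤ 0 := by
  intro α hα
  have := sign_nonneg (fun a => -g a) (fun a => -g' a) (fun a ha => (hd a ha).neg)
    (hs.symm.imp (fun h a ha => by have := h a ha; linarith)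
      (fun h a ha => by have := h a ha; linarith)) (by simpa using h) α hα
  linarith

lemma iSup_compl {n : ℕ} (hn : 0 < n) {Ω : Type} (l : Ω → Fin n → ℝ) (x : ℝ) :
    {ω | x ≤ ⨆ i, l ω i} = {ω | ∀ i, l ω i < x}ᶜ := by
  haveI : Nonempty (Fin n) := ⟨⟨0, hn⟩⟩
  ext ω
  simp only [Set.mem_ofPred_eq, Set.mem_compl_iff, not_forall, not_lt]
  constructor
  · intro h
    obtain ⟨i, hi⟩ := exists_eq_ciSup_of_finite (f := fun i => l ω i)
    exact ⟨i, by rw [hi]; exact h⟩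
  · rintro ⟨i, hi⟩
    exact hi.trans (le_ciSup (Set.finite_range (fun i => l ω i)).bddAbove i)

end SlepAux

/-- **Slepian lemma for 1-permanental vectors.** Let `{G_α : α ∈ [0,1]}` be a
family of inverse M-matrices with positive definite symmetric part, entrywise differentiable in
`α` with derivatives of constant sign, with `ℓ_α` 1-permanental with kernel `G_α`. If moreover
`G₁,ᵢᵢ ≤ G₀,ᵢᵢ` for all `i` and `G₁,ᵢⱼ ≥ G₀,ᵢⱼ` for `i ≠ j`, then `maxᵢ ℓ₀,ᵢ` stochastically
dominates `maxᵢ ℓ₁,ᵢ`: `P(maxᵢ ℓ₀,ᵢ ≥ x) ≥ P(maxᵢ ℓ₁,ᵢ ≥ x)` for every `x ≥ 0`. -/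
theorem slepian_onePermanental {n : ℕ} (hn : 0 < n)
    (G : ℝ → Matrix (Fin n) (Fin n) ℝ) (G' : ℝ → Matrix (Fin n) (Fin n) ℝ)
    (hderiv : ∀ i j, ∀ α ∈ Set.Icc (0 : ℝ) 1,
      HasDerivWithinAt (fun a => G a i j) (G' α i j) (Set.Icc (0 : ℝ) 1) α)
    (hsign : ∀ i j, (∀ α ∈ Set.Icc (0 : ℝ) 1, 0 ≤ G' α i j) ∨
      (∀ α ∈ Set.Icc (0 : ℝ) 1, G' α i j ≤ 0))
    (hnn : ∀ α ∈ Set.Icc (0 : ℝ) 1, ∀ i j, 0 ≤ G α i j)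
    (hinvble : ∀ α ∈ Set.Icc (0 : ℝ) 1, IsUnit (G α).det)
    (hMmat : ∀ α ∈ Set.Icc (0 : ℝ) 1, ∀ i j, i ≠ j → (G α)⁻¹ i j ≤ 0)
    (hpd : ∀ α ∈ Set.Icc (0 : ℝ) 1, ∀ x : Fin n → ℝ, x ≠ 0 → 0 < x ⬝ᵥ (G α).mulVec x)
    {Ω : Type} [MeasurableSpace Ω] (μ : Measure Ω) [IsProbabilityMeasure μ]
    (ℓ : ℝ → Ω → Fin n → ℝ) (hmeas : ∀ α, Measurable (ℓ α))
    (hpos : ∀ α ω i, 0 ≤ ℓ α ω i)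
    (hperm : ∀ α ∈ Set.Icc (0 : ℝ) 1, ∀ lam : Fin n → ℝ, (∀ i, 0 ≤ lam i) →
      ∫ ω, Real.exp (-(∑ i, lam i * ℓ α ω i)) ∂μ =
        ((1 + Matrix.diagonal lam * G α).det)⁻¹)
    (hdiag : ∀ i, G 1 i i ≤ G 0 i i)
    (hoff : ∀ i j, i ≠ j → G 0 i j ≤ G 1 i j) :
    ∀ x : ℝ, 0 ≤ x →
      μ {ω | x ≤ ⨆ i, ℓ 1 ω i} ≤ μ {ω | x ≤ ⨆ i, ℓ 0 ω i} := by
  intro x hx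
  rcases hx.eq_or_lt with rfl | hx
  · refine (measure_mono (Set.subset_univ _)).trans (le_of_eq ?_)
    congr 1
    symm
    rw [Set.eq_univ_iff_forall]
    intro ω
    exact Real.iSup_nonneg fun i => hpos 0 ω i
  have I0 : (0 : ℝ) ∈ Set.Icc (0 : ℝ) 1 := by simp
  have I1 : (1 : ℝ) ∈ Set.Icc (0 : ℝ) 1 := by simp
  have hG : ∀ α ∈ Set.Icc (0 : ℝ) 1, SlepAux.Good (G α) := fun α hα =>
    ⟨hnn α hα, hinvble α hα, hMmat α hα, hpd α hα⟩
  have hd : ∀ i, ∀ α ∈ Set.Icc (0 : ℝ) 1, G' α i i ≤ 0 := fun i =>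
    SlepAux.sign_nonpos (fun a => G a i i) (fun a => G' a i i) (hderiv i i) (hsign i i) (hdiag i)
  have ho : ∀ i j, i ≠ j → ∀ α ∈ Set.Icc (0 : ℝ) 1, 0 ≤ G' α i j := fun i j hij =>
    SlepAux.sign_nonneg (fun a => G a i j) (fun a => G' a i j) (hderiv i j) (hsign i j)
      (hoff i j hij)
  have hbox : ∀ y : ℝ, 0 < y →
      μ {ω | ∀ i, ℓ 0 ω i < y} ≤ μ {ω | ∀ i, ℓ 1 ω i ≤ y} := by
    intro y hy
    refine SlepAux.box_le μ (ℓ 0) (ℓ 1) (hmeas 0) (hmeas 1) (hpos 0) (hpos 1) y hy fun N => ?_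
    have hθ : (0 : ℝ) ≤ ((N : ℝ) + 1) / y := by positivity
    have hpc := fun α (hα : α ∈ Set.Icc (0 : ℝ) 1) =>
      SlepAux.perm_coeff (hG α hα) (((N : ℝ) + 1) / y) hθ μ (ℓ α) (hmeas α) (hpos α) (hperm α hα)
    have hmono := SlepAux.boxSum_monotone G G' hderiv hd ho hG _ hθ (fun α hα => (hpc α hα).1)
      (Finsupp.equivFunOnFinite.symm fun _ => N)
    have h := hmono I0 I1 zero_le_one
    dsimp only at h
    rw [(hpc 0 I0).2, (hpc 1 I1).2] at h
    simpa using h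
  have hlt := SlepAux.box_lt μ (ℓ 0) (ℓ 1) hbox x hx
  have hm : ∀ α, MeasurableSet {ω | ∀ i, ℓ α ω i < x} := by
    intro α
    have : {ω | ∀ i, ℓ α ω i < x} = ⋂ i, {ω | ℓ α ω i < x} := by ext ω; simp
    rw [this]
    exact MeasurableSet.iInter fun i =>
      measurableSet_lt ((measurable_pi_apply i).comp (hmeas α)) measurable_const
  rw [SlepAux.iSup_compl hn, SlepAux.iSup_compl hn, prob_compl_eq_one_sub (hm 1),
    prob_compl_eq_one_sub (hm 0)]
  exact tsub_le_tsub_left hlt 1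
end
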